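/- arXiv:1205.3416 — 3 statements merged into one kernel-verified Lean document; each statement's English description precedes it below -/
import Mathlib

section
/- For any G-module V and any integer k ≥ 1, there exists an irreducible (simple) G-module U such that β_k(G, V ⊕ U) ≥ β_k(F[V], F[V]^G) + 1. -/
open scoped ENNReal


open MvPolynomial

/-- The (right) action of a group element `g` on the coordinate ring `F[V]` of `V = ι → F`,
determined by `(f^g)(v) = f (g • v)` where `g` acts on `V` through the representation `ρ`. -/
noncomputable def polyAct {F : Type*} [Field F] {G : Type*} [Group G] {ι : Type*}
    [Fintype ι] [DecidableEq ι] (ρ : Representation F G (ι → F)) (g : G) :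
    MvPolynomial ι F →ₐ[F] MvPolynomial ι F :=
  MvPolynomial.aeval (fun i => ∑ j, (ρ g (Pi.single j 1) i) • MvPolynomial.X j)

/-- The ring of polynomial invariants `F[V]^G`. -/
noncomputable def invRing {F : Type*} [Field F] {G : Type*} [Group G] {ι : Type*}
    [Fintype ι] [DecidableEq ι] (ρ : Representation F G (ι → F)) :
    Subalgebra F (MvPolynomial ι F) :=
  ⨅ g : G, AlgHom.equalizer (polyAct ρ g) (AlgHom.id F (MvPolynomial ι F))

/-- The degree `d` homogeneous component of a graded subalgebra `S` of the polynomial ring,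
as a subspace of the polynomial ring. -/
noncomputable def subComp {F : Type*} [Field F] {ι : Type*} (S : Subalgebra F (MvPolynomial ι F)) (d : ℕ) :
    Submodule F (MvPolynomial ι F) :=
  Subalgebra.toSubmodule S ⊓ homogeneousSubmodule ι F d

/-- `S_+`, the span of the homogeneous elements of positive degree of `S`. -/
noncomputable def subPos {F : Type*} [Field F] {ι : Type*} (S : Subalgebra F (MvPolynomial ι F)) :
    Submodule F (MvPolynomial ι F) :=
  ⨆ d ∈ Set.Ioi (0 : ℕ), subComp S d

/-- `β_k(S)`, the top degree of `S_+ / S_+^{k+1}`, i.e. the supremum (in `ℕ∞`) of the degrees `d`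
such that the degree `d` component of `S_+` is not contained in `S_+^{k+1}`. -/
noncomputable def betaAlg {F : Type*} [Field F] {ι : Type*}
    (S : Subalgebra F (MvPolynomial ι F)) (k : ℕ) : ℕ∞ :=
  sSup ((fun d : ℕ => (d : ℕ∞)) '' {d | 0 < d ∧ ¬ subComp S d ≤ subPos S ^ (k + 1)})

/-- `β_k(F[V], S)`, the top degree of `F[V]/S_+^k F[V]`, i.e. the supremum (in `ℕ∞`) of the
degrees `d` such that the degree `d` component of the polynomial ring is not contained in
`S_+^k ⬝ F[V]`. -/
noncomputable def betaMod {F : Type*} [Field F] {ι : Type*}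
    (S : Subalgebra F (MvPolynomial ι F)) (k : ℕ) : ℕ∞ :=
  sSup ((fun d : ℕ => (d : ℕ∞)) ''
    {d | ¬ homogeneousSubmodule ι F d ≤ subPos S ^ k * (⊤ : Submodule F (MvPolynomial ι F))})

/-- `β_k(G)`, the supremum over all finite dimensional `G`-modules `V` of `β_k(F[V]^G)`. -/
noncomputable def betaGrp (F : Type*) [Field F] (G : Type*) [Group G] (k : ℕ) : ℕ∞ :=
  ⨆ (n : ℕ) (ρ : Representation F G (Fin n → F)), betaAlg (invRing ρ) k

/-- `S` is a finitely generated module over its subalgebra `T`. -/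
noncomputable def fgOver {F : Type*} [Field F] {ι : Type*} (S T : Subalgebra F (MvPolynomial ι F)) : Prop :=
  ∃ B : Finset (MvPolynomial ι F), (B : Set (MvPolynomial ι F)) ⊆ S ∧
    Subalgebra.toSubmodule S ≤ Subalgebra.toSubmodule T * Submodule.span F (B : Set (MvPolynomial ι F))

/-- `σ(S)`: the minimal `d` such that `S` is a finitely generated module over the subalgebra
`F[S_{≤ d}]` generated by the homogeneous elements of `S` of degree at most `d`. -/
noncomputable def sigmaAlg {F : Type*} [Field F] {ι : Type*}
    (S : Subalgebra F (MvPolynomial ι F)) : ℕ :=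
  sInf {d : ℕ | fgOver S (Algebra.adjoin F (⋃ i ∈ Set.Iic d, (subComp S i : Set (MvPolynomial ι F))))}

/-- `σ(G)`, the supremum over all finite dimensional `G`-modules `V` of `σ(F[V]^G)`. -/
noncomputable def sigmaGrp (F : Type*) [Field F] (G : Type*) [Group G] : ℕ∞ :=
  ⨆ (n : ℕ) (ρ : Representation F G (Fin n → F)), (sigmaAlg (invRing ρ) : ℕ∞)

/-- An irreducible (simple, nonzero) representation. -/
def IsIrredRep {F : Type*} [Field F] {G : Type*} [Group G] {V : Type*}
    [AddCommGroup V] [Module F V] (π : Representation F G V) : Prop :=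
  Nontrivial V ∧ ∀ W : Submodule F V, (∀ g : G, ∀ x ∈ W, π g x ∈ W) → W = ⊥ ∨ W = ⊤

/-- The direct sum of two representations on spaces of the form `ι → F`. -/
noncomputable def repSum {F : Type*} [Field F] {G : Type*} [Group G] {α β : Type*}
    (ρ : Representation F G (α → F)) (π : Representation F G (β → F)) :
    Representation F G (α ⊕ β → F) where
  toFun g :=
    { toFun := fun v => Sum.elim (fun i => ρ g (fun i' => v (Sum.inl i')) i)
        (fun j => π g (fun j' => v (Sum.inr j')) j)
      map_add' := fun u v => by
        funext x
        cases x with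
        | inl i => exact congrFun (map_add (ρ g) _ _) i
        | inr j => exact congrFun (map_add (π g) _ _) j
      map_smul' := fun c v => by
        funext x
        cases x with
        | inl i => exact congrFun (map_smul (ρ g) c _) i
        | inr j => exact congrFun (map_smul (π g) c _) j }
  map_one' := by
    ext v x
    cases x <;> simp
  map_mul' := fun g h => by
    ext v x
    cases x <;> simp [map_mul]

/-- The direct sum of a finite family of representations on spaces of the form `κ i → F`. -/
noncomputable def repSigma {F : Type*} [Field F] {G : Type*} [Group G] {n : ℕ}
    {κ : Fin n → Type*} (ρ : ∀ i, Representation F G (κ i → F)) :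
    Representation F G ((Σ i, κ i) → F) where
  toFun g :=
    { toFun := fun v x => ρ x.1 g (fun j => v ⟨x.1, j⟩) x.2
      map_add' := fun u v => by funext x; exact congrFun (map_add (ρ x.1 g) _ _) x.2
      map_smul' := fun c v => by funext x; exact congrFun (map_smul (ρ x.1 g) c _) x.2 }
  map_one' := by
    ext v x
    simp
  map_mul' := fun g h => by
    ext v x
    simp [map_mul]

section Helpers

variable {F : Type*} [Field F] {G : Type*} [Group G]

theorem exists_minimal_stable [Finite G] (hG : (Nat.card G : F) ≠ 0)
    {M : Type*} [AddCommGroup M] [Module F M] (σ : Representation F G M)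
    (X N : Subrepresentation σ) [FiniteDimensional F X.toSubmodule] (hXN : ¬ X ≤ N) :
    ∃ W : Subrepresentation σ, W ≤ X ∧ ¬ W ≤ N ∧
      ∀ W' : Subrepresentation σ, W' ≤ W → W' = ⊥ ∨ W' = W := by
  have : NeZero (Nat.card G : F) := ⟨hG⟩
  have hss : ComplementedLattice (Subrepresentation σ) := inferInstance
  let P : Set (Subrepresentation σ) := {W | W ≤ X ∧ ¬ W ≤ N}
  obtain ⟨W, ⟨hWX, hWN⟩, hmin⟩ :=
    (measure (fun W : Subrepresentation σ => Module.finrank F W.toSubmodule)).wf.has_min P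
      ⟨X, le_rfl, hXN⟩
  have hmin' : ∀ W' : Subrepresentation σ, W' ≤ W → ¬ W' ≤ N → W' = W := by
    intro W' h1 h2
    by_contra hne
    have hlt : W'.toSubmodule < W.toSubmodule :=
      lt_of_le_of_ne h1 (fun h => hne (Subrepresentation.toSubmodule_injective h))
    have : FiniteDimensional F W.toSubmodule :=
      Submodule.finiteDimensional_of_le (S₂ := X.toSubmodule) hWX
    exact hmin W' ⟨h1.trans hWX, h2⟩ (Submodule.finrank_lt_finrank_of_lt hlt)
  refine ⟨W, hWX, hWN, ?_⟩
  obtain ⟨C, hC⟩ := hss.exists_isCompl (W ⊓ N)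
  have hWC : ¬ W ⊓ C ≤ N := by
    intro h
    apply hWN
    intro x hx
    have htop : (W ⊓ N ⊔ C).toSubmodule = ⊤ := by rw [hC.sup_eq_top]; rfl
    have hx' : x ∈ (W ⊓ N).toSubmodule ⊔ C.toSubmodule := by
      have : x ∈ (⊤ : Submodule F M) := trivial
      rw [← htop] at this
      exact this
    obtain ⟨a, ha, c, hc, rfl⟩ := Submodule.mem_sup.1 hx'
    have haW : a ∈ W.toSubmodule := ha.1
    have hcW : c ∈ W.toSubmodule := (Submodule.add_mem_iff_right _ haW).1 hx
    exact N.toSubmodule.add_mem ha.2 (h (show c ∈ W ⊓ C from ⟨hcW, hc⟩))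
  have hle : W ≤ C := by
    have := hmin' _ inf_le_left hWC
    exact inf_eq_left.1 this
  have hbot : W ⊓ N = ⊥ := by
    have := hC.inf_eq_bot
    rwa [inf_eq_left.2 (inf_le_left.trans hle)] at this
  intro W' hW'
  by_cases h : W' ≤ N
  · left
    exact le_bot_iff.1 (hbot ▸ le_inf hW' h)
  · exact Or.inr (hmin' _ hW' h)

section act

variable {ι : Type*} [Fintype ι] [DecidableEq ι] (ρ : Representation F G (ι → F))

theorem polyAct_X (g : G) (i : ι) :
    polyAct ρ g (X i) = ∑ j, (ρ g (Pi.single j 1) i) • (X j : MvPolynomial ι F) := by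
  simp [polyAct]

theorem rep_apply_sum (g : G) (v : ι → F) (i : ι) :
    ρ g v i = ∑ j, v j * ρ g (Pi.single j 1) i := by
  conv_lhs => rw [pi_eq_sum_univ' v]
  simp [map_sum, Finset.sum_apply]

theorem polyAct_one : polyAct ρ 1 = AlgHom.id F _ := by
  apply MvPolynomial.algHom_ext
  intro i
  rw [polyAct_X]
  simp [Pi.single_apply]

theorem polyAct_mul (g h : G) (p : MvPolynomial ι F) :
    polyAct ρ (g * h) p = polyAct ρ h (polyAct ρ g p) := by
  have : polyAct ρ (g * h) = (polyAct ρ h).comp (polyAct ρ g) := by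
    apply MvPolynomial.algHom_ext
    intro i
    rw [AlgHom.comp_apply, polyAct_X, polyAct_X, map_sum]
    simp only [map_smul, polyAct_X, map_mul, Module.End.mul_apply]
    simp only [Finset.smul_sum, smul_smul]
    rw [Finset.sum_comm]
    refine Finset.sum_congr rfl fun j _ => ?_
    rw [← Finset.sum_smul, rep_apply_sum ρ g]
    simp only [mul_comm]
  rw [this]; rfl

/-- The left action on the coordinate ring. -/
noncomputable def polyRep : Representation F G (MvPolynomial ι F) where
  toFun g := (polyAct ρ g⁻¹).toLinearMap
  map_one' := by
    apply LinearMap.ext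
    intro p
    simp [polyAct_one]
  map_mul' g h := by
    apply LinearMap.ext
    intro p
    simp [polyAct_mul]

theorem polyRep_apply (g : G) (p : MvPolynomial ι F) : polyRep ρ g p = polyAct ρ g⁻¹ p := rfl

theorem polyAct_homog (g : G) {d : ℕ} {p : MvPolynomial ι F} (hp : p.IsHomogeneous d) :
    (polyAct ρ g p).IsHomogeneous d := by
  have := hp.aeval (n := 1) (fun i => ∑ j, (ρ g (Pi.single j 1) i) • (X j : MvPolynomial ι F)) (by
    intro i
    apply IsHomogeneous.sum
    intro j _
    exact Submodule.smul_mem (homogeneousSubmodule ι F 1) _ (isHomogeneous_X F j))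
  rw [one_mul] at this
  exact this

theorem mem_invRing {p : MvPolynomial ι F} :
    p ∈ invRing ρ ↔ ∀ g, polyAct ρ g p = p := by
  simp [invRing, Algebra.mem_iInf, AlgHom.mem_equalizer]

end act

theorem subPos_le {ι : Type*} (S : Subalgebra F (MvPolynomial ι F)) :
    subPos S ≤ Subalgebra.toSubmodule S :=
  iSup₂_le fun _ _ => inf_le_left

theorem mem_subPos {ι : Type*} (S : Subalgebra F (MvPolynomial ι F)) {d : ℕ} (hd : 0 < d)
    {p : MvPolynomial ι F} (hp : p ∈ S) (hh : p.IsHomogeneous d) : p ∈ subPos S :=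
  (le_iSup₂_of_le (f := fun d (_ : d ∈ Set.Ioi (0 : ℕ)) => subComp S d) d hd le_rfl)
    (show p ∈ subComp S d from ⟨hp, hh⟩)

theorem subPow_mul_mem {ι : Type*} (T : Submodule F (MvPolynomial ι F))
    {p : MvPolynomial ι F} (hp : p ∈ T * (⊤ : Submodule F (MvPolynomial ι F)))
    (q : MvPolynomial ι F) : q * p ∈ T * (⊤ : Submodule F (MvPolynomial ι F)) := by
  have h := Submodule.mul_mem_mul hp (show q ∈ (⊤ : Submodule F (MvPolynomial ι F)) from trivial)
  rw [mul_assoc] at h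
  rw [mul_comm q p]
  exact (mul_le_mul' le_rfl le_top :
    T * (⊤ * ⊤) ≤ T * (⊤ : Submodule F (MvPolynomial ι F))) h

theorem stable_power {ι : Type*} [Fintype ι] [DecidableEq ι] (ρ : Representation F G (ι → F))
    (k : ℕ) (g : G) {p : MvPolynomial ι F}
    (hp : p ∈ subPos (invRing ρ) ^ k * (⊤ : Submodule F (MvPolynomial ι F))) :
    polyAct ρ g p ∈ subPos (invRing ρ) ^ k * (⊤ : Submodule F (MvPolynomial ι F)) := by
  have hmap : (subPos (invRing ρ)).map (polyAct ρ g).toLinearMap ≤ subPos (invRing ρ) := by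
    rintro _ ⟨q, hq, rfl⟩
    have := (mem_invRing ρ).1 (subPos_le _ hq) g
    simpa [this] using hq
  have h := Submodule.mem_map_of_mem (f := (polyAct ρ g).toLinearMap) hp
  rw [Submodule.map_mul, Submodule.map_pow] at h
  exact mul_le_mul' (pow_le_pow_left' hmap k) le_top h

theorem X_pow_mem [Fintype G] {ι : Type*} [Fintype ι] [DecidableEq ι]
    (ρ : Representation F G (ι → F)) (i : ι) :
    (X i : MvPolynomial ι F) ^ (Fintype.card G) ∈
      subPos (invRing ρ) * (⊤ : Submodule F (MvPolynomial ι F)) := by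
  classical
  let y : G → MvPolynomial ι F := fun g => - polyAct ρ g (X i)
  let P : Polynomial (MvPolynomial ι F) := ∏ g : G, (Polynomial.X + Polynomial.C (y g))
  have hmonic : P.Monic :=
    Polynomial.monic_prod_of_monic _ _ fun g _ => Polynomial.monic_X_add_C _
  have hdeg : P.natDegree = Fintype.card G := by
    rw [Polynomial.natDegree_prod_of_monic _ _ fun g _ => Polynomial.monic_X_add_C _]
    simp
  have hroot : P.eval (X i) = 0 := by
    rw [Polynomial.eval_prod]
    apply Finset.prod_eq_zero (Finset.mem_univ (1 : G))
    simp [y, polyAct_one]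
  have hinv : ∀ j, P.coeff j ∈ invRing ρ := by
    intro j
    rw [mem_invRing]
    intro h
    have hP : P.map (polyAct ρ h : MvPolynomial ι F →+* MvPolynomial ι F) = P := by
      rw [Polynomial.map_prod]
      refine Fintype.prod_equiv (Equiv.mulRight h) _ _ fun g => ?_
      simp [y, polyAct_mul]
    conv_rhs => rw [← hP]
    rw [Polynomial.coeff_map]
    rfl
  have hhom : ∀ j ≤ Fintype.card G, (P.coeff j).IsHomogeneous (Fintype.card G - j) := by
    intro j hj
    rw [Finset.prod_X_add_C_coeff _ _ (by simpa using hj)]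
    apply IsHomogeneous.sum
    intro t ht
    have hc := (Finset.mem_powersetCard.1 ht).2
    have := IsHomogeneous.prod t y (fun _ => 1)
      (fun g _ => (polyAct_homog ρ g (isHomogeneous_X F i)).neg)
    simpa [hc] using this
  rw [Polynomial.eval_eq_sum_range, hdeg, Finset.sum_range_succ, ← hdeg,
    hmonic.coeff_natDegree, one_mul, hdeg] at hroot
  rw [← neg_eq_of_add_eq_zero_right hroot]
  refine Submodule.neg_mem _ (Submodule.sum_mem _ fun j hj => ?_)
  have hj := Finset.mem_range.1 hj
  exact Submodule.mul_mem_mul (mem_subPos _ (Nat.sub_pos_of_lt hj) (hinv j) (hhom j hj.le)) trivial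

theorem homog_le_of_large [Fintype G] {ι : Type*} [Fintype ι] [DecidableEq ι]
    (ρ : Representation F G (ι → F)) (k d : ℕ)
    (hd : Fintype.card ι * (Fintype.card G * k) < d) :
    homogeneousSubmodule ι F d ≤
      subPos (invRing ρ) ^ k * (⊤ : Submodule F (MvPolynomial ι F)) := by
  intro p hp
  rw [p.as_sum]
  refine Submodule.sum_mem _ fun s hs => ?_
  have hsd : ∑ i, s i = d := by
    have h1 : s.degree = d := by
      by_contra hne
      exact (mem_support_iff.1 hs) (IsHomogeneous.coeff_eq_zero hp hne)
    rw [← h1, Finsupp.degree_eq_sum]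
  obtain ⟨i, hi⟩ : ∃ i, Fintype.card G * k ≤ s i := by
    by_contra! hcon
    have : ∑ i, s i ≤ ∑ _i : ι, Fintype.card G * k := Finset.sum_le_sum fun i _ => (hcon i).le
    simp at this
    omega
  have hX : (X i : MvPolynomial ι F) ^ (Fintype.card G * k) ∈
      subPos (invRing ρ) ^ k * (⊤ : Submodule F (MvPolynomial ι F)) := by
    have h := Submodule.pow_mem_pow _ (X_pow_mem ρ i) k
    rw [mul_pow, ← pow_mul] at h
    have hle : subPos (invRing ρ) ^ k * (⊤ : Submodule F (MvPolynomial ι F)) ^ k ≤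
        subPos (invRing ρ) ^ k * ⊤ := mul_le_mul' le_rfl le_top
    exact hle h
  have hsplit : monomial s (coeff s p) =
      monomial (s - Finsupp.single i (Fintype.card G * k)) (coeff s p) *
        (X i : MvPolynomial ι F) ^ (Fintype.card G * k) := by
    rw [X_pow_eq_monomial, monomial_mul, mul_one, tsub_add_cancel_of_le]
    exact Finsupp.single_le_iff.2 hi
  rw [hsplit]
  exact subPow_mul_mem _ hX _

theorem one_notMem {ι : Type*} (S : Subalgebra F (MvPolynomial ι F)) (k : ℕ) (hk : 1 ≤ k) :
    (1 : MvPolynomial ι F) ∉ subPos S ^ k * (⊤ : Submodule F (MvPolynomial ι F)) := by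
  intro h
  let K : Submodule F (MvPolynomial ι F) :=
    (RingHom.ker (constantCoeff (R := F) (σ := ι))).restrictScalars F
  have h0 : subPos S ≤ K := by
    refine iSup₂_le fun d hd => ?_
    rintro p ⟨_, hp⟩
    have hd' : (0 : ℕ) < d := hd
    exact IsHomogeneous.coeff_eq_zero hp (by simpa using hd'.ne)
  have hK : K * (⊤ : Submodule F (MvPolynomial ι F)) ≤ K := by
    rw [Submodule.mul_le]
    intro a ha b _
    exact Ideal.mul_mem_right b _ ha
  obtain ⟨l, rfl⟩ := Nat.exists_eq_add_of_le' hk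
  rw [pow_succ', mul_assoc] at h
  have := hK ((mul_le_mul' h0 le_top : _ ≤ _) h)
  have h1 : constantCoeff (R := F) (σ := ι) 1 = 0 := this
  simp at h1

section sum

variable {α β : Type*} [Fintype α] [DecidableEq α] [Fintype β] [DecidableEq β]
  (ρ : Representation F G (α → F)) (π : Representation F G (β → F))

theorem repSum_apply_inl (g : G) (v : α ⊕ β → F) (i : α) :
    repSum ρ π g v (Sum.inl i) = ρ g (fun i' => v (Sum.inl i')) i := rfl

theorem repSum_apply_inr (g : G) (v : α ⊕ β → F) (i : β) :
    repSum ρ π g v (Sum.inr i) = π g (fun i' => v (Sum.inr i')) i := rfl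

theorem single_inl_inl (j : α) : (fun i : α => (Pi.single (Sum.inl j) 1 : α ⊕ β → F) (Sum.inl i))
    = Pi.single j 1 := by
  ext i; simp [Pi.single_apply]

theorem single_inl_inr (j : α) : (fun i : β => (Pi.single (Sum.inl j) 1 : α ⊕ β → F) (Sum.inr i))
    = 0 := by
  ext i; simp [Pi.single_apply]

theorem single_inr_inl (j : β) : (fun i : α => (Pi.single (Sum.inr j) 1 : α ⊕ β → F) (Sum.inl i))
    = 0 := by
  ext i; simp [Pi.single_apply]

theorem single_inr_inr (j : β) : (fun i : β => (Pi.single (Sum.inr j) 1 : α ⊕ β → F) (Sum.inr i))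
    = Pi.single j 1 := by
  ext i; simp [Pi.single_apply]

theorem polyAct_X_inl (g : G) (i : α) :
    polyAct (repSum ρ π) g (X (Sum.inl i)) = rename Sum.inl (polyAct ρ g (X i)) := by
  simp only [polyAct_X, Fintype.sum_sum_type, repSum_apply_inl, single_inl_inl, single_inr_inl,
    map_sum, map_smul, rename_X]
  simp

theorem polyAct_X_inr (g : G) (i : β) :
    polyAct (repSum ρ π) g (X (Sum.inr i)) = rename Sum.inr (polyAct π g (X i)) := by
  simp only [polyAct_X, Fintype.sum_sum_type, repSum_apply_inr, single_inl_inr, single_inr_inr,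
    map_sum, map_smul, rename_X]
  simp

theorem polyAct_rename_inl (g : G) (p : MvPolynomial α F) :
    polyAct (repSum ρ π) g (rename Sum.inl p) = rename Sum.inl (polyAct ρ g p) := by
  have : (polyAct (repSum ρ π) g).comp (rename Sum.inl) = (rename Sum.inl).comp (polyAct ρ g) := by
    apply MvPolynomial.algHom_ext
    intro i
    simp [polyAct_X_inl]
  exact DFunLike.congr_fun this p

/-- Restriction of polynomials from `V ⊕ U` to `V`. -/
noncomputable def resV : MvPolynomial (α ⊕ β) F →ₐ[F] MvPolynomial α F :=
  aeval (Sum.elim X (fun _ => 0))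

theorem resV_polyAct (g : G) (p : MvPolynomial (α ⊕ β) F) :
    resV (polyAct (repSum ρ π) g p) = polyAct ρ g (resV p) := by
  have : (resV).comp (polyAct (repSum ρ π) g) = (polyAct ρ g).comp (resV (F := F) (β := β)) := by
    apply MvPolynomial.algHom_ext
    rintro (i | i)
    · rw [AlgHom.comp_apply, polyAct_X_inl]
      simp [polyAct_X, resV]
    · rw [AlgHom.comp_apply, polyAct_X_inr]
      simp [polyAct_X, resV]
  exact DFunLike.congr_fun this p

theorem resV_subPos : (subPos (invRing (repSum ρ π))).map resV.toLinearMap ≤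
    subPos (invRing ρ) := by
  rw [Submodule.map_le_iff_le_comap]
  refine iSup₂_le fun d hd => ?_
  rintro p ⟨hp, hh⟩
  refine mem_subPos _ hd ?_ ?_
  · rw [mem_invRing]
    intro g
    have := (mem_invRing _).1 hp g
    change polyAct ρ g (resV p) = resV p
    rw [← resV_polyAct, this]
  · have := IsHomogeneous.aeval (n := 1) hh (Sum.elim X (fun _ => 0) : α ⊕ β → MvPolynomial α F) (by
      rintro (i | i)
      · exact isHomogeneous_X F i
      · exact isHomogeneous_zero _ _ _)
    rw [one_mul] at this
    exact this

theorem deriv_mem (i : β) (k : ℕ) :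
    (subPos (invRing (repSum ρ π)) ^ (k + 1)).map
      (resV.toLinearMap ∘ₗ (pderiv (Sum.inr i)).toLinearMap) ≤
      subPos (invRing ρ) ^ k * (⊤ : Submodule F (MvPolynomial α F)) := by
  induction k with
  | zero => simp
  | succ k ih =>
    rw [Submodule.map_le_iff_le_comap, pow_succ, Submodule.mul_le]
    intro a ha b hb
    have h1 := ih (Submodule.mem_map_of_mem ha)
    have h2 := Submodule.mem_map_of_mem (f := resV.toLinearMap) ha
    rw [Submodule.map_pow] at h2
    have h2 := pow_le_pow_left' (resV_subPos ρ π) (k + 1) h2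
    have h3 := resV_subPos ρ π (Submodule.mem_map_of_mem hb)
    have h4 := Submodule.mul_mem_mul h3 h1
    rw [← mul_assoc, ← pow_succ'] at h4
    have h5 := Submodule.mul_mem_mul h2
      (show resV (pderiv (Sum.inr i) b) ∈ (⊤ : Submodule F (MvPolynomial α F)) from trivial)
    have h6 := Submodule.add_mem _ h5 h4
    change resV (pderiv (Sum.inr i) (a * b)) ∈
      subPos (invRing ρ) ^ (k + 1) * (⊤ : Submodule F (MvPolynomial α F))
    rw [Derivation.leibniz]
    simpa using h6

theorem key_notMem (k d : ℕ) (w : β → MvPolynomial α F) (hw : ∀ i, (w i).IsHomogeneous d)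
    (hact : ∀ g j, ∑ i, π g (Pi.single j 1) i • w i = polyAct ρ g⁻¹ (w j))
    (hbad : ∃ i, w i ∉ subPos (invRing ρ) ^ k * (⊤ : Submodule F (MvPolynomial α F))) :
    ¬ subComp (invRing (repSum ρ π)) (d + 1) ≤ subPos (invRing (repSum ρ π)) ^ (k + 1) := by
  intro hle
  obtain ⟨i₀, hi₀⟩ := hbad
  let f : MvPolynomial (α ⊕ β) F := ∑ i, rename Sum.inl (w i) * X (Sum.inr i)
  have hf : f ∈ subComp (invRing (repSum ρ π)) (d + 1) := by
    constructor
    · refine (mem_invRing _).2 fun g => ?_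
      have h1 : ∀ j, ∑ i, π g (Pi.single j 1) i • polyAct ρ g (w i) = w j := by
        intro j
        have := congrArg (polyAct ρ g) (hact g j)
        rw [← polyAct_mul, inv_mul_cancel, polyAct_one] at this
        simpa using this
      simp only [f, map_sum, map_mul, polyAct_rename_inl, polyAct_X_inr]
      simp only [polyAct_X, map_sum, map_smul, rename_X, Finset.mul_sum]
      rw [Finset.sum_comm]
      refine Finset.sum_congr rfl fun j _ => ?_
      conv_rhs => rw [← h1 j]
      simp only [map_sum, map_smul, Finset.sum_mul, smul_mul_assoc, mul_smul_comm]
    · exact IsHomogeneous.sum _ _ _ fun i _ =>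
        ((hw i).rename_isHomogeneous).mul (isHomogeneous_X F _)
  apply hi₀
  have h := deriv_mem ρ π i₀ k (Submodule.mem_map_of_mem (hle hf))
  have hval : resV (pderiv (Sum.inr i₀) f) = w i₀ := by
    have hres : ∀ p : MvPolynomial α F, resV (β := β) (rename Sum.inl p) = p := by
      intro p
      simp only [resV, aeval_rename]
      exact aeval_X_left_apply p
    have hX : ∀ i : β, resV (X (Sum.inr i) : MvPolynomial (α ⊕ β) F) = 0 := by
      intro i; simp [resV]
    simp only [f, map_sum, Derivation.leibniz, map_add, smul_eq_mul, map_mul, hres, hX, zero_mul,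
      add_zero, pderiv_X]
    rw [Finset.sum_eq_single i₀]
    · simp
    · intro b _ hb
      simp [Pi.single_apply, hb]
    · simp
  rw [← hval]
  exact h

end sum

end Helpers

/-- For any `G`-module `V` and any `k ≥ 1`, there exists an irreducible `G`-module `U` such
that `β_k(G, V ⊕ U) ≥ β_k(F[V], F[V]^G) + 1`. -/
theorem betaAlg_repSum_irreducible_ge {F : Type*} [Field F] {G : Type*} [Group G] [Finite G]
    (hG : (Nat.card G : F) ≠ 0) (n : ℕ) (ρ : Representation F G (Fin n → F))
    (k : ℕ) (hk : 1 ≤ k) :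
    ∃ (m : ℕ) (π : Representation F G (Fin m → F)), IsIrredRep π ∧
      betaMod (invRing ρ) k + 1 ≤ betaAlg (invRing (repSum ρ π)) k := by
  classical
  have := Fintype.ofFinite G
  let D : Set ℕ := {d | ¬ homogeneousSubmodule (Fin n) F d ≤
    subPos (invRing ρ) ^ k * (⊤ : Submodule F (MvPolynomial (Fin n) F))}
  have hbdd : BddAbove D := by
    refine ⟨Fintype.card (Fin n) * (Fintype.card G * k), fun d hd => ?_⟩
    by_contra hcon
    exact hd (homog_le_of_large ρ k d (not_le.1 hcon))
  have hne : D.Nonempty := ⟨0, fun h => one_notMem (invRing ρ) k hk (h (isHomogeneous_one _ _))⟩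
  obtain ⟨d, hdD, hdmax⟩ : ∃ d ∈ D, ∀ e ∈ D, e ≤ d :=
    ⟨sSup D, Nat.sSup_mem hne hbdd, fun e he => le_csSup hbdd he⟩
  have hbeta : betaMod (invRing ρ) k ≤ d := by
    refine sSup_le ?_
    rintro _ ⟨e, he, rfl⟩
    exact Nat.cast_le.2 (hdmax e he)
  let X₀ : Subrepresentation (polyRep ρ) :=
    ⟨homogeneousSubmodule (Fin n) F d, fun g p hp => polyAct_homog ρ g⁻¹ hp⟩
  let N₀ : Subrepresentation (polyRep ρ) :=
    ⟨subPos (invRing ρ) ^ k * ⊤, fun g p hp => stable_power ρ k g⁻¹ hp⟩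
  have hfin : FiniteDimensional F X₀.toSubmodule :=
    Module.Finite.iff_fg.2 (homogeneousSubmodule_fg (Fin n) F d)
  obtain ⟨W, hWX, hWN, hWirr⟩ := exists_minimal_stable hG (polyRep ρ) X₀ N₀ hdD
  have hfinW : FiniteDimensional F W.toSubmodule :=
    Submodule.finiteDimensional_of_le (S₂ := X₀.toSubmodule) hWX
  let b := Module.finBasis F W.toSubmodule
  let e := b.equivFun
  let π : Representation F G (Fin (Module.finrank F W.toSubmodule) → F) :=
    { toFun := fun g => e.toLinearMap ∘ₗ W.toRepresentation g ∘ₗ e.symm.toLinearMap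
      map_one' := by
        apply LinearMap.ext
        intro v
        simp
      map_mul' := fun g h => by
        apply LinearMap.ext
        intro v
        simp }
  have hπ : ∀ g v, π g v = e (W.toRepresentation g (e.symm v)) := fun g v => rfl
  refine ⟨_, π, ⟨?_, ?_⟩, ?_⟩
  · have : Nontrivial W.toSubmodule := by
      rw [Submodule.nontrivial_iff_ne_bot]
      intro h
      apply hWN
      intro x hx
      have hx' : x ∈ W.toSubmodule := hx
      rw [h, Submodule.mem_bot] at hx'
      rw [hx']
      exact N₀.toSubmodule.zero_mem
    exact e.symm.toEquiv.nontrivial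
  · intro Y hY
    let Y' : Subrepresentation (polyRep ρ) :=
      ⟨(Y.comap e.toLinearMap).map W.toSubmodule.subtype, by
        rintro g _ ⟨x, hx, rfl⟩
        refine ⟨W.toRepresentation g x, ?_, rfl⟩
        have := hY g _ hx
        rw [hπ] at this
        simpa using this⟩
    have hmemY : ∀ y : Fin (Module.finrank F W.toSubmodule) → F,
        y ∈ Y ↔ ((e.symm y : W.toSubmodule) : MvPolynomial (Fin n) F) ∈ Y'.toSubmodule := by
      intro y
      simp [Y']
    rcases hWirr Y' (by rintro _ ⟨x, hx, rfl⟩; exact x.2) with h | h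
    · left
      rw [eq_bot_iff]
      intro y hy
      have h1 := (hmemY y).1 hy
      rw [h] at h1
      have h2 : ((e.symm y : W.toSubmodule) : MvPolynomial (Fin n) F) = 0 := h1
      simpa using h2
    · right
      rw [eq_top_iff]
      intro y _
      rw [hmemY, h]
      exact (e.symm y).2
  · have hkey := key_notMem ρ π k d (fun i => (b i : MvPolynomial (Fin n) F))
      (fun i => hWX (b i).2) (by
        intro g j
        have h1 : W.toRepresentation g (b j) = ∑ i, π g (Pi.single j 1) i • b i := by
          have h2 : e.symm (Pi.single j 1) = b j := by simp [e]
          rw [hπ, h2]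
          exact (b.sum_equivFun _).symm
        have h3 := congrArg (fun x : W.toSubmodule => (x : MvPolynomial (Fin n) F)) h1
        simp only [Submodule.coe_sum, Submodule.coe_smul] at h3
        rw [← h3]
        rfl) (by
        by_contra! hcon
        apply hWN
        intro x hx
        have h1 := b.sum_equivFun ⟨x, hx⟩
        have h3 := congrArg (fun x : W.toSubmodule => (x : MvPolynomial (Fin n) F)) h1
        simp only [Submodule.coe_sum, Submodule.coe_smul] at h3
        rw [← h3]
        exact N₀.toSubmodule.sum_mem fun i _ => N₀.toSubmodule.smul_mem _ (hcon i))
    have hle : ((d + 1 : ℕ) : ℕ∞) ≤ betaAlg (invRing (repSum ρ π)) k :=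
      le_sSup ⟨d + 1, ⟨Nat.succ_pos d, hkey⟩, rfl⟩
    refine le_trans ?_ hle
    push_cast
    exact add_le_add_left hbeta 1
end

section
/- For any integers r, s ≥ 1 and any finite groups G and H whose orders are invertible in F, β_{r+s−1}(G × H) ≥ β_r(G) + β_s(H) − 1. -/
open scoped ENNReal


open MvPolynomial

set_option linter.unusedSectionVars false

namespace BetaProd

section basic
variable {F : Type*} [Field F] {G : Type*} [Group G] {ι : Type*} [Fintype ι] [DecidableEq ι]
  (ρ : Representation F G (ι → F))

lemma polyAct_X (g : G) (i : ι) :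
    polyAct ρ g (X i) = ∑ j, (ρ g (Pi.single j 1) i) • (X j : MvPolynomial ι F) := by
  simp [polyAct]

lemma rho_apply (g : G) (v : ι → F) (i : ι) :
    ρ g v i = ∑ j, v j * ρ g (Pi.single j 1) i := by
  have h : v = ∑ j, v j • (Pi.single j 1 : ι → F) := by
    ext k
    simp [Finset.sum_apply, Pi.single_apply]
  conv_lhs => rw [h, map_sum]
  simp [Finset.sum_apply]

lemma polyAct_mul (g h : G) (f : MvPolynomial ι F) :
    polyAct ρ g (polyAct ρ h f) = polyAct ρ (h * g) f := by
  have : (polyAct ρ g).comp (polyAct ρ h) = polyAct ρ (h * g) := by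
    apply MvPolynomial.algHom_ext
    intro i
    simp only [AlgHom.comp_apply, polyAct_X, map_sum, map_smul, map_mul, Module.End.mul_apply]
    simp only [Finset.smul_sum, smul_smul]
    rw [Finset.sum_comm]
    refine Finset.sum_congr rfl fun j _ => ?_
    rw [← Finset.sum_smul, rho_apply ρ h (ρ g (Pi.single j 1)) i]
    congr 1
    exact Finset.sum_congr rfl fun k _ => mul_comm _ _
  exact DFunLike.congr_fun this f

lemma polyAct_one (f : MvPolynomial ι F) : polyAct ρ 1 f = f := by
  have : polyAct ρ 1 = AlgHom.id F _ := by
    apply MvPolynomial.algHom_ext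
    intro i
    simp [polyAct_X, Pi.single_apply]
  rw [this]; rfl

lemma polyAct_hom (g : G) {f : MvPolynomial ι F} {d : ℕ} (hf : f.IsHomogeneous d) :
    (polyAct ρ g f).IsHomogeneous d := by
  have := hf.aeval (fun i => ∑ j, (ρ g (Pi.single j 1) i) • (X j : MvPolynomial ι F)) (n := 1)
    (fun i => by
      refine IsHomogeneous.sum _ _ _ fun j _ => ?_
      rw [smul_eq_C_mul]
      exact isHomogeneous_C_mul_X _ _)
  simpa [polyAct] using this

lemma mem_inv {f : MvPolynomial ι F} : f ∈ invRing ρ ↔ ∀ g, polyAct ρ g f = f := by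
  simp [invRing, Algebra.mem_iInf, AlgHom.mem_equalizer]

lemma subComp_le_subPos {S : Subalgebra F (MvPolynomial ι F)} {d : ℕ} (hd : 0 < d) :
    subComp S d ≤ subPos S :=
  le_iSup₂_of_le (f := fun (d : ℕ) (_ : d ∈ Set.Ioi (0 : ℕ)) => subComp S d) d hd le_rfl

lemma subPos_le_alg {S : Subalgebra F (MvPolynomial ι F)} :
    subPos S ≤ Subalgebra.toSubmodule S :=
  iSup₂_le fun _ _ => inf_le_left

lemma subPos_pow_le_alg {S : Subalgebra F (MvPolynomial ι F)} (n : ℕ) :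
    subPos S ^ n ≤ Subalgebra.toSubmodule S := by
  induction n with
  | zero =>
    rw [pow_zero, Submodule.one_le]
    exact S.one_mem
  | succ n ih =>
    rw [pow_succ, Submodule.mul_le]
    intro a ha b hb
    exact S.mul_mem (ih ha) (subPos_le_alg hb)

lemma constantCoeff_subPos {S : Subalgebra F (MvPolynomial ι F)} {f : MvPolynomial ι F}
    (hf : f ∈ subPos S) : constantCoeff f = 0 := by
  have : subPos S ≤ LinearMap.ker (MvPolynomial.lcoeff F (0 : ι →₀ ℕ)) := by
    refine iSup₂_le fun d hd => ?_
    rintro x ⟨_, hx⟩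
    rw [LinearMap.mem_ker]
    exact IsHomogeneous.coeff_eq_zero hx (by simpa using (ne_of_gt hd).symm)
  exact this hf

/-- An algebra morphism mapping graded components to graded components maps powers of the
positive part into powers of the positive part. -/
lemma map_subPos_pow {κ : Type*} {S : Subalgebra F (MvPolynomial ι F)}
    {T : Subalgebra F (MvPolynomial κ F)} (ψ : MvPolynomial ι F →ₐ[F] MvPolynomial κ F)
    (h : ∀ d, ∀ f ∈ subComp S d, ψ f ∈ subComp T d) (n : ℕ) {f : MvPolynomial ι F}
    (hf : f ∈ subPos S ^ n) : ψ f ∈ subPos T ^ n := by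
  have h1 : (subPos S).map ψ.toLinearMap ≤ subPos T := by
    rw [Submodule.map_le_iff_le_comap]
    refine iSup₂_le fun d hd x hx => ?_
    exact (le_iSup₂_of_le (f := fun (d : ℕ) (_ : d ∈ Set.Ioi (0 : ℕ)) => subComp T d)
      d hd le_rfl) (h d x hx)
  have h2 : (subPos S ^ n).map ψ.toLinearMap ≤ subPos T ^ n := by
    rw [Submodule.map_pow]
    exact pow_le_pow_left' h1 n
  exact h2 ⟨f, hf, rfl⟩

end basic

section reynolds
variable {F : Type*} [Field F] {G : Type*} [Group G] [Fintype G]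
  {ι : Type*} [Fintype ι] [DecidableEq ι]
  (ρ : Representation F G (ι → F))

/-- The Reynolds operator. -/
noncomputable def rey : MvPolynomial ι F →ₗ[F] MvPolynomial ι F :=
  (Fintype.card G : F)⁻¹ • ∑ g : G, (polyAct ρ g).toLinearMap

lemma rey_apply (f : MvPolynomial ι F) :
    rey ρ f = (Fintype.card G : F)⁻¹ • ∑ g : G, polyAct ρ g f := by
  simp [rey]

lemma rey_mem (f : MvPolynomial ι F) : rey ρ f ∈ invRing ρ := by
  rw [mem_inv]
  intro g
  simp only [rey_apply, map_smul, map_sum, polyAct_mul]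
  congr 1
  exact Fintype.sum_equiv (Equiv.mulRight g) _ _ fun _ => rfl

lemma rey_of_mem (hG : (Fintype.card G : F) ≠ 0) {f : MvPolynomial ι F} (hf : f ∈ invRing ρ) :
    rey ρ f = f := by
  rw [mem_inv] at hf
  simp only [rey_apply, hf, Finset.sum_const, Finset.card_univ]
  rw [← Nat.cast_smul_eq_nsmul F, smul_smul, inv_mul_cancel₀ hG, one_smul]

lemma rey_mul {p : MvPolynomial ι F} (hp : p ∈ invRing ρ) (f : MvPolynomial ι F) :
    rey ρ (p * f) = p * rey ρ f := by
  rw [mem_inv] at hp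
  simp only [rey_apply, map_mul, hp, ← Finset.mul_sum, mul_smul_comm]

lemma rey_hom {f : MvPolynomial ι F} {d : ℕ} (hf : f.IsHomogeneous d) :
    (rey ρ f).IsHomogeneous d := by
  rw [rey_apply, smul_eq_C_mul]
  exact (IsHomogeneous.sum _ _ _ fun g _ => polyAct_hom ρ g hf).C_mul _

lemma rey_subPos {f : MvPolynomial ι F} (hf : constantCoeff f = 0) :
    rey ρ f ∈ subPos (invRing ρ) := by
  rw [← sum_homogeneousComponent f, map_sum]
  refine Submodule.sum_mem _ fun d _ => ?_
  rcases Nat.eq_zero_or_pos d with rfl | hd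
  · rw [homogeneousComponent_zero]
    have : coeff 0 f = 0 := hf
    simp [this]
  · exact subComp_le_subPos hd ⟨rey_mem ρ _, rey_hom ρ (homogeneousComponent_isHomogeneous _ _)⟩

/-- Step 1: from invariants to the module of all polynomials. -/
lemma exists_not_mem_of_not_le (hG : (Fintype.card G : F) ≠ 0) {k d : ℕ}
    (h : ¬ subComp (invRing ρ) (d + 1) ≤ subPos (invRing ρ) ^ (k + 1)) :
    ∃ f : MvPolynomial ι F, f.IsHomogeneous d ∧
      f ∉ subPos (invRing ρ) ^ k * (⊤ : Submodule F (MvPolynomial ι F)) := by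
  by_contra! hc
  apply h
  rintro f ⟨hf, hfd⟩
  rw [← rey_of_mem ρ hG hf]
  have key : ∀ z ∈ subPos (invRing ρ) ^ k * (⊤ : Submodule F (MvPolynomial ι F)), ∀ i,
      rey ρ (z * X i) ∈ subPos (invRing ρ) ^ (k + 1) := by
    intro z hz i
    induction hz using Submodule.mul_induction_on' with
    | mem_mul_mem p hp q hq =>
      rw [mul_assoc, rey_mul ρ (subPos_pow_le_alg k hp), pow_succ]
      exact Submodule.mul_mem_mul hp (rey_subPos ρ (by simp))
    | add x _ y _ hx hy =>
      rw [add_mul, map_add]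
      exact add_mem hx hy
  have hf' : f ∈ homogeneousSubmodule ι F d * homogeneousSubmodule ι F 1 := by
    rw [← homogeneousSubmodule_one_pow, ← pow_succ, homogeneousSubmodule_one_pow]
    exact hfd
  rw [homogeneousSubmodule_one_eq_span_X] at hf'
  clear hf hfd
  induction hf' using Submodule.mul_induction_on' with
  | mem_mul_mem p hp q hq =>
    have hp' := hc p hp
    clear hp
    induction hq using Submodule.span_induction with
    | mem x hx =>
      obtain ⟨i, rfl⟩ := hx
      exact key p hp' i
    | zero => simp
    | add x y _ _ hx hy => rw [mul_add, map_add]; exact add_mem hx hy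
    | smul c x _ hx => rw [mul_smul_comm, map_smul]; exact Submodule.smul_mem _ _ hx
  | add x _ y _ hx hy => rw [map_add]; exact add_mem hx hy

end reynolds

section sums
variable {F : Type*} [Field F] {K : Type*} [Group K]
  {ι : Type*} [Fintype ι] [DecidableEq ι] {κ : Type*} [Fintype κ] [DecidableEq κ]

/-- Direct sum of two coordinate representations. -/
noncomputable def sumRep (ρ : Representation F K (ι → F)) (σ : Representation F K (κ → F)) :
    Representation F K (ι ⊕ κ → F) where
  toFun g :=
    { toFun := fun v => Sum.elim (ρ g (fun i => v (Sum.inl i))) (σ g (fun i => v (Sum.inr i)))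
      map_add' := fun v w => by
        have h1 : (fun i => (v + w) (Sum.inl i)) =
          (fun i => v (Sum.inl i)) + (fun i => w (Sum.inl i)) := rfl
        have h2 : (fun i => (v + w) (Sum.inr i)) =
          (fun i => v (Sum.inr i)) + (fun i => w (Sum.inr i)) := rfl
        rw [h1, h2, map_add, map_add]
        ext (i | i) <;> rfl
      map_smul' := fun c v => by
        have h1 : (fun i => (c • v) (Sum.inl i)) = c • (fun i => v (Sum.inl i)) := rfl
        have h2 : (fun i => (c • v) (Sum.inr i)) = c • (fun i => v (Sum.inr i)) := rfl
        rw [h1, h2, map_smul, map_smul]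
        ext (i | i) <;> rfl }
  map_one' := by
    apply LinearMap.ext
    intro v
    ext (i | i) <;> simp
  map_mul' g h := by
    apply LinearMap.ext
    intro v
    ext (i | i) <;> simp

variable (ρ : Representation F K (ι → F)) (σ : Representation F K (κ → F))

lemma sumRep_inl (g : K) (v : ι ⊕ κ → F) (i : ι) :
    sumRep ρ σ g v (Sum.inl i) = ρ g (fun i => v (Sum.inl i)) i := rfl

lemma sumRep_inr (g : K) (v : ι ⊕ κ → F) (i : κ) :
    sumRep ρ σ g v (Sum.inr i) = σ g (fun i => v (Sum.inr i)) i := rfl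

lemma single_ll (j : ι) : (fun i : ι => (Pi.single (Sum.inl j) 1 : ι ⊕ κ → F) (Sum.inl i)) =
    Pi.single j 1 := by
  ext i; simp [Pi.single_apply]
lemma single_lr (j : ι) : (fun i : κ => (Pi.single (Sum.inl j) 1 : ι ⊕ κ → F) (Sum.inr i)) =
    0 := by
  ext i; simp
lemma single_rl (j : κ) : (fun i : ι => (Pi.single (Sum.inr j) 1 : ι ⊕ κ → F) (Sum.inl i)) =
    0 := by
  ext i; simp
lemma single_rr (j : κ) : (fun i : κ => (Pi.single (Sum.inr j) 1 : ι ⊕ κ → F) (Sum.inr i)) =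
    Pi.single j 1 := by
  ext i; simp [Pi.single_apply]

lemma polyAct_sum_Xl (g : K) (i : ι) : polyAct (sumRep ρ σ) g (X (Sum.inl i)) =
    rename Sum.inl (polyAct ρ g (X i)) := by
  simp only [polyAct_X, Fintype.sum_sum_type, sumRep_inl, single_ll, single_rl, map_zero,
    Pi.zero_apply, zero_smul, Finset.sum_const_zero, add_zero, map_sum, map_smul, rename_X]

lemma polyAct_sum_Xr (g : K) (i : κ) : polyAct (sumRep ρ σ) g (X (Sum.inr i)) =
    rename Sum.inr (polyAct σ g (X i)) := by
  simp only [polyAct_X, Fintype.sum_sum_type, sumRep_inr, single_lr, single_rr, map_zero,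
    Pi.zero_apply, zero_smul, Finset.sum_const_zero, zero_add, map_sum, map_smul, rename_X]

lemma polyAct_inl (g : K) (f : MvPolynomial ι F) :
    polyAct (sumRep ρ σ) g (rename Sum.inl f) = rename Sum.inl (polyAct ρ g f) := by
  have : (polyAct (sumRep ρ σ) g).comp (rename Sum.inl) =
      (rename Sum.inl).comp (polyAct ρ g) := by
    apply MvPolynomial.algHom_ext
    intro i
    simp [polyAct_sum_Xl]
  exact DFunLike.congr_fun this f

lemma polyAct_inr (g : K) (f : MvPolynomial κ F) :
    polyAct (sumRep ρ σ) g (rename Sum.inr f) = rename Sum.inr (polyAct σ g f) := by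
  have : (polyAct (sumRep ρ σ) g).comp (rename Sum.inr) =
      (rename Sum.inr).comp (polyAct σ g) := by
    apply MvPolynomial.algHom_ext
    intro i
    simp [polyAct_sum_Xr]
  exact DFunLike.congr_fun this f

/-- Restriction of polynomials to the first summand. -/
noncomputable def eps (F : Type*) [Field F] (ι κ : Type*) :
    MvPolynomial (ι ⊕ κ) F →ₐ[F] MvPolynomial ι F :=
  aeval (Sum.elim X (fun _ => 0))

@[simp] lemma eps_inl (f : MvPolynomial ι F) : eps F ι κ (rename Sum.inl f) = f := by
  have : (eps F ι κ).comp (rename Sum.inl) = AlgHom.id F _ := by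
    apply MvPolynomial.algHom_ext
    intro i
    simp [eps]
  exact DFunLike.congr_fun this f

lemma eps_act (g : K) (f : MvPolynomial (ι ⊕ κ) F) :
    eps F ι κ (polyAct (sumRep ρ σ) g f) = polyAct ρ g (eps F ι κ f) := by
  have : (eps F ι κ).comp (polyAct (sumRep ρ σ) g) = (polyAct ρ g).comp (eps F ι κ) := by
    apply MvPolynomial.algHom_ext
    rintro (i | i)
    · simp only [AlgHom.comp_apply, polyAct_sum_Xl, eps_inl]
      simp [eps]
    · simp only [AlgHom.comp_apply, polyAct_sum_Xr]
      rw [polyAct_X]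
      simp [eps]
  exact DFunLike.congr_fun this f

lemma eps_comp {d : ℕ} {f : MvPolynomial (ι ⊕ κ) F} (hf : f ∈ subComp (invRing (sumRep ρ σ)) d) :
    eps F ι κ f ∈ subComp (invRing ρ) d := by
  obtain ⟨h1, h2⟩ := hf
  refine ⟨?_, ?_⟩
  · have h1' := (mem_inv _).1 h1
    refine (mem_inv _).2 fun g => ?_
    rw [← eps_act ρ σ, h1']
  · have := IsHomogeneous.aeval (n := 1) h2 (Sum.elim X (fun _ => 0) : ι ⊕ κ → MvPolynomial ι F) (by
      rintro (i | i)
      · exact isHomogeneous_X _ _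
      · exact isHomogeneous_zero _ _ _)
    rw [one_mul] at this
    exact this

/-- Derivative with respect to a variable of the second summand, restricted to the first one. -/
lemma deriv_mem (y : κ) (n : ℕ) {f : MvPolynomial (ι ⊕ κ) F}
    (hf : f ∈ subPos (invRing (sumRep ρ σ)) ^ (n + 1)) :
    eps F ι κ (pderiv (Sum.inr y) f) ∈
      subPos (invRing ρ) ^ n * (⊤ : Submodule F (MvPolynomial ι F)) := by
  induction n generalizing f with
  | zero => rw [pow_zero, one_mul]; trivial
  | succ n ih =>
    rw [pow_succ] at hf
    induction hf using Submodule.mul_induction_on' with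
    | mem_mul_mem p hp q hq =>
      rw [Derivation.leibniz, map_add, smul_eq_mul, smul_eq_mul, map_mul, map_mul]
      refine add_mem ?_ ?_
      · exact Submodule.mul_mem_mul (map_subPos_pow _ (fun d f hf => eps_comp ρ σ hf) _ hp) trivial
      · rw [pow_succ', mul_assoc]
        refine Submodule.mul_mem_mul ?_ (ih hp)
        have := map_subPos_pow (T := invRing ρ) (eps F ι κ) (fun d f hf => eps_comp ρ σ hf) 1
          ((pow_one (subPos (invRing (sumRep ρ σ)))).symm ▸ hq)
        rwa [pow_one] at this
    | add x _ y _ hx hy => rw [map_add, map_add]; exact add_mem hx hy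

end sums

section regular
variable {F : Type*} [Field F] {K : Type*} [Group K] [Fintype K] [DecidableEq K]
  {ι : Type*} [Fintype ι] [DecidableEq ι]

/-- The regular representation on functions. -/
noncomputable def regRep (F : Type*) [Field F] (K : Type*) [Group K] :
    Representation F K (K → F) where
  toFun g :=
    { toFun := fun v k => v (k * g)
      map_add' := fun _ _ => rfl
      map_smul' := fun _ _ => rfl }
  map_one' := by
    apply LinearMap.ext
    intro v
    ext k
    simp
  map_mul' g h := by
    apply LinearMap.ext
    intro v
    ext k
    simp [mul_assoc]

lemma regRep_X (g k : K) : polyAct (regRep F K) g (X k) = X (k * g) := by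
  rw [polyAct_X]
  have : ∀ j, regRep F K g (Pi.single j 1) k = if k * g = j then 1 else 0 := by
    intro j
    change (Pi.single j 1 : K → F) (k * g) = _
    rw [Pi.single_apply]
  simp [this]

/-- Step 2: from the module of all polynomials back to invariants of a bigger representation. -/
lemma exists_not_le (ρ : Representation F K (ι → F)) {k d : ℕ} {f : MvPolynomial ι F}
    (hf : f.IsHomogeneous d)
    (hk : f ∉ subPos (invRing ρ) ^ k * (⊤ : Submodule F (MvPolynomial ι F))) :
    ¬ subComp (invRing (sumRep ρ (regRep F K))) (d + 1) ≤
      subPos (invRing (sumRep ρ (regRep F K))) ^ (k + 1) := by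
  intro hle
  apply hk
  set P : MvPolynomial (ι ⊕ K) F :=
    ∑ h : K, rename Sum.inl (polyAct ρ h f) * X (Sum.inr h) with hP
  have hmem : P ∈ subComp (invRing (sumRep ρ (regRep F K))) (d + 1) := by
    refine ⟨(mem_inv _).2 fun g => ?_, ?_⟩
    · rw [hP, map_sum]
      refine Fintype.sum_equiv (Equiv.mulRight g) _ _ fun h => ?_
      rw [map_mul, polyAct_inl, polyAct_mul, polyAct_sum_Xr, regRep_X, rename_X]
      rfl
    · exact IsHomogeneous.sum _ _ _ fun h _ =>
        ((polyAct_hom ρ h hf).rename_isHomogeneous).mul (isHomogeneous_X _ _)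
  have h1 := deriv_mem ρ (regRep F K) 1 k (hle hmem)
  have h2 : eps F ι K (pderiv (Sum.inr 1) P) = f := by
    rw [hP, map_sum, map_sum]
    have : ∀ h : K, eps F ι K (pderiv (Sum.inr 1) (rename Sum.inl (polyAct ρ h f) * X (Sum.inr h)))
        = if h = 1 then polyAct ρ h f else 0 := by
      intro h
      rw [Derivation.leibniz, map_add, smul_eq_mul, smul_eq_mul, map_mul, map_mul, eps_inl]
      have e1 : eps F ι K (X (Sum.inr h)) = 0 := by simp [eps]
      rw [e1, zero_mul, add_zero, pderiv_X, Pi.single_apply]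
      by_cases hh : h = 1
      · simp [hh]
      · have : (Sum.inr h : ι ⊕ K) ≠ Sum.inr 1 := by simpa using hh
        simp [hh]
    simp only [this]
    rw [Finset.sum_ite_eq' Finset.univ (1 : K) (fun h => polyAct ρ h f)]
    simp [polyAct_one]
  rwa [h2] at h1

end regular

section transport
variable {F : Type*} [Field F] {K : Type*} [Group K]
  {ι : Type*} [Fintype ι] [DecidableEq ι] {κ : Type*} [Fintype κ] [DecidableEq κ]

/-- Reindexing a coordinate representation. -/
noncomputable def reRep (ρ : Representation F K (ι → F)) (e : ι ≃ κ) :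
    Representation F K (κ → F) where
  toFun g := (LinearMap.funLeft F F e.symm) ∘ₗ (ρ g) ∘ₗ (LinearMap.funLeft F F e)
  map_one' := by
    apply LinearMap.ext
    intro v
    ext k
    simp [LinearMap.funLeft_apply]
  map_mul' g h := by
    apply LinearMap.ext
    intro v
    ext k
    have : ∀ w : ι → F, (LinearMap.funLeft F F e) ((LinearMap.funLeft F F e.symm) w) = w := by
      intro w; ext i; simp [LinearMap.funLeft_apply]
    simp [this]

variable (ρ : Representation F K (ι → F)) (e : ι ≃ κ)

lemma polyAct_reRep (g : K) (f : MvPolynomial ι F) :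
    polyAct (reRep ρ e) g (rename e f) = rename e (polyAct ρ g f) := by
  have : (polyAct (reRep ρ e) g).comp (rename e) = (rename (R := F) e).comp (polyAct ρ g) := by
    apply MvPolynomial.algHom_ext
    intro i
    simp only [AlgHom.comp_apply, rename_X, polyAct_X, map_sum, map_smul]
    refine (Fintype.sum_equiv e _ _ fun j => ?_).symm
    congr 1
    have : LinearMap.funLeft F F e (Pi.single (e j) 1) = Pi.single j 1 := by
      ext k
      simp [LinearMap.funLeft_apply, Pi.single_apply]
    change _ = (LinearMap.funLeft F F e.symm) (ρ g (LinearMap.funLeft F F e (Pi.single (e j) 1))) (e i)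
    rw [this]
    simp [LinearMap.funLeft_apply]
  exact DFunLike.congr_fun this f

lemma le_betaGrp {k d : ℕ} (hd : 0 < d)
    (h : ¬ subComp (invRing ρ) d ≤ subPos (invRing ρ) ^ (k + 1)) :
    (d : ℕ∞) ≤ betaGrp F K k := by
  let e := Fintype.equivFin ι
  refine le_iSup₂_of_le (Fintype.card ι) (reRep ρ e) (le_sSup ⟨d, ⟨hd, fun hle => h ?_⟩, rfl⟩)
  rintro f ⟨hf, hfd⟩
  have h1 : rename e f ∈ subComp (invRing (reRep ρ e)) d := by
    refine ⟨(mem_inv _).2 fun g => ?_, IsHomogeneous.rename_isHomogeneous hfd⟩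
    rw [polyAct_reRep, (mem_inv ρ).1 hf]
  have h2 := map_subPos_pow (S := invRing (reRep ρ e)) (T := invRing ρ) (rename e.symm) ?_ _ (hle h1)
  · simpa [rename_rename] using h2
  · rintro d f ⟨hf, hfd⟩
    refine ⟨(mem_inv _).2 fun g => ?_, IsHomogeneous.rename_isHomogeneous hfd⟩
    apply rename_injective e e.injective
    rw [← polyAct_reRep]
    simpa [rename_rename] using (mem_inv _).1 hf g

end transport

section product
open TensorProduct
variable {F : Type*} [Field F] {G H : Type*} [Group G] [Group H] [Fintype G] [Fintype H]
  {ι : Type*} [Fintype ι] [DecidableEq ι] {κ : Type*} [Fintype κ] [DecidableEq κ]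

/-- Outer direct sum of representations of `G` and `H`, as a representation of `G × H`. -/
noncomputable def prodRep (ρ : Representation F G (ι → F)) (σ : Representation F H (κ → F)) :
    Representation F (G × H) (ι ⊕ κ → F) :=
  sumRep (MonoidHom.comp ρ (MonoidHom.fst G H)) (MonoidHom.comp σ (MonoidHom.snd G H))

variable (ρ : Representation F G (ι → F)) (σ : Representation F H (κ → F))

lemma rey_prod (v : MvPolynomial ι F) (w : MvPolynomial κ F) :
    rey (prodRep ρ σ) (rename Sum.inl v * rename Sum.inr w) =
      rename Sum.inl (rey ρ v) * rename Sum.inr (rey σ w) := by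
  have h : ∀ x : G × H, polyAct (prodRep ρ σ) x (rename Sum.inl v * rename Sum.inr w) =
      rename Sum.inl (polyAct ρ x.1 v) * rename Sum.inr (polyAct σ x.2 w) := by
    intro x
    rw [map_mul, prodRep, polyAct_inl, polyAct_inr]
    rfl
  simp only [rey_apply, h, map_smul, map_sum, Fintype.card_prod, Nat.cast_mul, mul_inv,
    Fintype.sum_prod_type, smul_mul_smul_comm, Finset.sum_mul_sum]

lemma monomial_split (m : ι ⊕ κ →₀ ℕ) : ∃ (a : ι →₀ ℕ) (b : κ →₀ ℕ),
    a.degree + b.degree = m.degree ∧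
    (monomial m 1 : MvPolynomial (ι ⊕ κ) F) =
      rename Sum.inl (monomial a 1) * rename Sum.inr (monomial b 1) := by
  refine ⟨(Finsupp.sumFinsuppEquivProdFinsupp m).1, (Finsupp.sumFinsuppEquivProdFinsupp m).2, ?_, ?_⟩
  · simp [Finsupp.degree_eq_sum, Fintype.sum_sum_type]
  · rw [rename_monomial, rename_monomial, monomial_mul, one_mul]
    refine congrArg (fun t => monomial t (1 : F)) (Finsupp.ext ?_)
    rintro (i | i)
    · rw [Finsupp.add_apply, Finsupp.mapDomain_apply Sum.inl_injective,
        Finsupp.mapDomain_of_notMem_range _ _ (by simp)]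
      simp
    · rw [Finsupp.add_apply, Finsupp.mapDomain_apply Sum.inr_injective,
        Finsupp.mapDomain_of_notMem_range _ _ (by simp)]
      simp

lemma rey_monomial_mem {a : ι →₀ ℕ} (ha : 0 < a.degree) :
    rey ρ (monomial a 1) ∈ subPos (invRing ρ) :=
  subComp_le_subPos ha ⟨rey_mem ρ _, rey_hom ρ (isHomogeneous_monomial _ rfl)⟩

/-- The positive part of the invariants of `G × H` is contained in any ideal-like comap. -/
lemma subPos_prod_le (hG : (Fintype.card G : F) ≠ 0) (hH : (Fintype.card H : F) ≠ 0)
    (I : Ideal (MvPolynomial (ι ⊕ κ) F))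
    (h1 : ∀ f ∈ subPos (invRing ρ), rename Sum.inl f ∈ I)
    (h2 : ∀ f ∈ subPos (invRing σ), rename Sum.inr f ∈ I) :
    ∀ f ∈ subPos (invRing (prodRep ρ σ)), f ∈ I := by
  have : subPos (invRing (prodRep ρ σ)) ≤ I.restrictScalars F := by
    refine iSup₂_le fun d hd => ?_
    rintro f ⟨hf, hfd⟩
    rw [Submodule.restrictScalars_mem]
    have hGH : (Fintype.card (G × H) : F) ≠ 0 := by
      rw [Fintype.card_prod, Nat.cast_mul]
      exact mul_ne_zero hG hH
    rw [← rey_of_mem (prodRep ρ σ) hGH hf, f.as_sum, map_sum]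
    refine Ideal.sum_mem _ fun m hm => ?_
    have hmd : m.degree = d := by
      by_contra hne
      exact (mem_support_iff.1 hm) (IsHomogeneous.coeff_eq_zero hfd hne)
    obtain ⟨a, b, hab, he⟩ := monomial_split (F := F) m
    have : monomial m (coeff m f) = coeff m f • (monomial m 1 : MvPolynomial (ι ⊕ κ) F) := by
      rw [smul_monomial, smul_eq_mul, mul_one]
    rw [this, map_smul, he, rey_prod, smul_eq_C_mul]
    refine Ideal.mul_mem_left _ _ ?_
    have hd' : 0 < d := hd
    rcases Nat.eq_zero_or_pos a.degree with ha | ha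
    · exact Ideal.mul_mem_left _ _ (h2 _ (rey_monomial_mem σ (by omega)))
    · exact Ideal.mul_mem_right _ _ (h1 _ (rey_monomial_mem ρ ha))
  exact this

lemma mul_top_absorb (N : Submodule F (MvPolynomial ι F)) {x : MvPolynomial ι F}
    (hx : x ∈ N * (⊤ : Submodule F (MvPolynomial ι F))) (c : MvPolynomial ι F) :
    c * x ∈ N * (⊤ : Submodule F (MvPolynomial ι F)) := by
  induction hx using Submodule.mul_induction_on' with
  | mem_mul_mem p hp q hq =>
    rw [mul_left_comm]
    exact Submodule.mul_mem_mul hp Submodule.mem_top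
  | add x _ y _ hx hy => rw [mul_add]; exact add_mem hx hy

lemma mul_top_mul (N M : Submodule F (MvPolynomial ι F)) {x y : MvPolynomial ι F}
    (hx : x ∈ N * (⊤ : Submodule F (MvPolynomial ι F))) (hy : y ∈ M) :
    x * y ∈ N * M * (⊤ : Submodule F (MvPolynomial ι F)) := by
  induction hx using Submodule.mul_induction_on' with
  | mem_mul_mem p hp q hq =>
    rw [mul_right_comm p q]
    exact Submodule.mul_mem_mul (Submodule.mul_mem_mul hp hy) Submodule.mem_top
  | add x _ y _ hx hy => rw [add_mul]; exact add_mem hx hy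

lemma ideal_pow_le (M : Submodule F (MvPolynomial ι F)) (n : ℕ) {x : MvPolynomial ι F}
    (hx : x ∈ Ideal.span (M : Set (MvPolynomial ι F)) ^ n) :
    x ∈ M ^ n * (⊤ : Submodule F (MvPolynomial ι F)) := by
  induction n generalizing x with
  | zero => rw [pow_zero, one_mul]; exact Submodule.mem_top
  | succ n ih =>
    rw [pow_succ] at hx
    induction hx using Submodule.mul_induction_on' with
    | mem_mul_mem p hp q hq =>
      have hp' := ih hp
      clear hp
      rw [pow_succ]
      induction hq using Submodule.span_induction with
      | mem x hx => exact mul_top_mul _ _ hp' hx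
      | zero => rw [mul_zero]; exact zero_mem _
      | add x y _ _ hx hy => rw [mul_add]; exact add_mem hx hy
      | smul c x _ hx =>
        rw [smul_eq_mul, mul_left_comm]
        exact mul_top_absorb _ hx c
    | add x _ y _ hx hy => exact add_mem hx hy

lemma pow_mul_top_le (M : Submodule F (MvPolynomial ι F)) (I : Ideal (MvPolynomial ι F))
    (h : ∀ f ∈ M, f ∈ I) (n : ℕ) {x : MvPolynomial ι F}
    (hx : x ∈ M ^ n * (⊤ : Submodule F (MvPolynomial ι F))) : x ∈ I ^ n := by
  have h1 : ∀ y ∈ M ^ n, y ∈ I ^ n := by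
    clear hx
    induction n with
    | zero => intro y _; simp
    | succ n ih =>
      intro y hy
      rw [pow_succ] at hy
      induction hy using Submodule.mul_induction_on' with
      | mem_mul_mem p hp q hq =>
        rw [pow_succ]
        exact Ideal.mul_mem_mul (ih p hp) (h q hq)
      | add x _ y _ hx hy => exact add_mem hx hy
  induction hx using Submodule.mul_induction_on' with
  | mem_mul_mem p hp q hq => exact Ideal.mul_mem_right _ _ (h1 p hp)
  | add x _ y _ hx hy => exact add_mem hx hy

lemma tmul_ne {A B : Type*} [AddCommGroup A] [Module F A] [AddCommGroup B] [Module F B]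
    {a : A} {b : B} (ha : a ≠ 0) (hb : b ≠ 0) : a ⊗ₜ[F] b ≠ 0 := by
  intro h
  have h1 : ∃ l : Module.Dual F A, l a ≠ 0 := by
    by_contra! hc
    exact ha ((Module.forall_dual_apply_eq_zero_iff F a).1 hc)
  have h2 : ∃ l : Module.Dual F B, l b ≠ 0 := by
    by_contra! hc
    exact hb ((Module.forall_dual_apply_eq_zero_iff F b).1 hc)
  obtain ⟨l, hl⟩ := h1
  obtain ⟨m, hm⟩ := h2
  have h3 := congrArg (fun t => TensorProduct.lid F F (TensorProduct.map l m t)) h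
  simp [hl, hm] at h3

/-- Auxiliary form of step 3, for a general target algebra. -/
lemma prod_eq_zero (hG : (Fintype.card G : F) ≠ 0) (hH : (Fintype.card H : F) ≠ 0) {r s : ℕ}
    {f : MvPolynomial ι F} {g : MvPolynomial κ F} {T : Type*} [CommRing T] [Algebra F T]
    (l : MvPolynomial ι F →ₐ[F] T) (m : MvPolynomial κ F →ₐ[F] T)
    (hl0 : ∀ x ∈ Ideal.span (subPos (invRing ρ) : Set (MvPolynomial ι F)) ^ r, l x = 0)
    (hm0 : ∀ x ∈ Ideal.span (subPos (invRing σ) : Set (MvPolynomial κ F)) ^ s, m x = 0)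
    (hfg : rename Sum.inl f * rename Sum.inr g ∈
      subPos (invRing (prodRep ρ σ)) ^ (r + s - 1) *
        (⊤ : Submodule F (MvPolynomial (ι ⊕ κ) F))) : l f * m g = 0 := by
  let φ : MvPolynomial (ι ⊕ κ) F →ₐ[F] T :=
    aeval (Sum.elim (fun i => l (X i)) (fun i => m (X i)))
  have hl : ∀ p, φ (rename Sum.inl p) = l p := by
    have : φ.comp (rename Sum.inl) = l := by
      apply MvPolynomial.algHom_ext
      intro i
      simp [φ]
    exact DFunLike.congr_fun this
  have hm : ∀ p, φ (rename Sum.inr p) = m p := by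
    have : φ.comp (rename Sum.inr) = m := by
      apply MvPolynomial.algHom_ext
      intro i
      simp [φ]
    exact DFunLike.congr_fun this
  obtain ⟨I, hI'⟩ : ∃ I : Ideal T, I =
    (Ideal.span (subPos (invRing ρ) : Set (MvPolynomial ι F))).map l := ⟨_, rfl⟩
  obtain ⟨J, hJ'⟩ : ∃ J : Ideal T, J =
    (Ideal.span (subPos (invRing σ) : Set (MvPolynomial κ F))).map m := ⟨_, rfl⟩
  have hI : I ^ r = 0 := by
    rw [hI', ← Ideal.map_pow, Submodule.zero_eq_bot, Ideal.map_eq_bot_iff_le_ker]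
    exact hl0
  have hJ : J ^ s = 0 := by
    rw [hJ', ← Ideal.map_pow, Submodule.zero_eq_bot, Ideal.map_eq_bot_iff_le_ker]
    exact hm0
  have hIJ : (I + J) ^ (r + s - 1) = 0 :=
    (Commute.all I J).add_pow_eq_zero_of_add_le_succ_of_pow_eq_zero hI hJ (by omega)
  have h1 := pow_mul_top_le _ ((I + J).comap φ) (subPos_prod_le ρ σ hG hH _ ?_ ?_) _ hfg
  · have h2 := Ideal.le_comap_pow _ _ h1
    rw [hIJ, Ideal.mem_comap, map_mul, hl, hm] at h2
    exact h2
  · intro p hp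
    rw [Ideal.mem_comap, hl]
    exact Ideal.mem_sup_left (hI' ▸ Ideal.mem_map_of_mem _ (Ideal.subset_span hp))
  · intro p hp
    rw [Ideal.mem_comap, hm]
    exact Ideal.mem_sup_right (hJ' ▸ Ideal.mem_map_of_mem _ (Ideal.subset_span hp))

/-- Step 3: the product of two polynomials outside of the powers of the Hilbert ideals. -/
lemma prod_not_mem (hG : (Fintype.card G : F) ≠ 0) (hH : (Fintype.card H : F) ≠ 0) {r s : ℕ}
    {f : MvPolynomial ι F} {g : MvPolynomial κ F}
    (hf : f ∉ subPos (invRing ρ) ^ r * (⊤ : Submodule F (MvPolynomial ι F)))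
    (hg : g ∉ subPos (invRing σ) ^ s * (⊤ : Submodule F (MvPolynomial κ F))) :
    rename Sum.inl f * rename Sum.inr g ∉
      subPos (invRing (prodRep ρ σ)) ^ (r + s - 1) *
        (⊤ : Submodule F (MvPolynomial (ι ⊕ κ) F)) := by
  intro hfg
  obtain ⟨a, ha⟩ : ∃ a, a = Ideal.span (subPos (invRing ρ) : Set (MvPolynomial ι F)) ^ r :=
    ⟨_, rfl⟩
  obtain ⟨b, hb⟩ : ∃ b, b = Ideal.span (subPos (invRing σ) : Set (MvPolynomial κ F)) ^ s :=
    ⟨_, rfl⟩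
  have h := prod_eq_zero ρ σ hG hH
    (T := (MvPolynomial ι F ⧸ a) ⊗[F] (MvPolynomial κ F ⧸ b))
    ((Algebra.TensorProduct.includeLeft).comp (Ideal.Quotient.mkₐ F a))
    ((Algebra.TensorProduct.includeRight).comp (Ideal.Quotient.mkₐ F b)) ?_ ?_ hfg
  · have h3 : (Ideal.Quotient.mkₐ F a f) ⊗ₜ[F] (Ideal.Quotient.mkₐ F b g) = 0 := by
      rw [← h]
      simp only [AlgHom.comp_apply, Algebra.TensorProduct.includeLeft_apply,
        Algebra.TensorProduct.includeRight_apply, Algebra.TensorProduct.tmul_mul_tmul,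
        mul_one, one_mul]
    refine tmul_ne ?_ ?_ h3
    · intro h0
      exact hf (ideal_pow_le _ _ (ha ▸ Ideal.Quotient.eq_zero_iff_mem.1 h0))
    · intro h0
      exact hg (ideal_pow_le _ _ (hb ▸ Ideal.Quotient.eq_zero_iff_mem.1 h0))
  · intro x hx
    have : Ideal.Quotient.mkₐ F a x = 0 := Ideal.Quotient.eq_zero_iff_mem.2 (ha ▸ hx)
    rw [AlgHom.comp_apply, this, map_zero]
  · intro x hx
    have : Ideal.Quotient.mkₐ F b x = 0 := Ideal.Quotient.eq_zero_iff_mem.2 (hb ▸ hx)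
    rw [AlgHom.comp_apply, this, map_zero]

end product

/-- There is always a degree contributing to `β_k`, for `k ≥ 1`. -/
lemma exists_nontriv (F : Type*) [Field F] (G : Type*) [Group G] [Finite G] (k : ℕ) (hk : 1 ≤ k) :
    (1 : ℕ∞) ≤ betaGrp F G k := by
  classical
  have := Fintype.ofFinite G
  have := exists_not_le (K := G) (k := k) (Representation.trivial F G (Fin 0 → F))
    (isHomogeneous_one (Fin 0) F) ?_
  · exact_mod_cast le_betaGrp _ (by omega) this
  · intro h
    have h1 := pow_mul_top_le _ (RingHom.ker (constantCoeff (R := F) (σ := Fin 0)))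
      (fun f hf => constantCoeff_subPos hf) k h
    have h2 := Ideal.pow_le_self (by omega) h1
    rw [RingHom.mem_ker] at h2
    simp at h2

lemma le_of_forall {F : Type*} [Field F] {G : Type*} [Group G] {k : ℕ} {B C : ℕ∞}
    (h1 : (1 : ℕ∞) ≤ betaGrp F G k)
    (h : ∀ (n : ℕ) (ρ : Representation F G (Fin n → F)) (d : ℕ),
      ¬ subComp (invRing ρ) (d + 1) ≤ subPos (invRing ρ) ^ (k + 1) → ((d + 1 : ℕ) : ℕ∞) + B ≤ C) :
    betaGrp F G k + B ≤ C := by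
  let s : Set ℕ∞ := {x | ∃ (n : ℕ) (ρ : Representation F G (Fin n → F)) (d : ℕ),
      ¬ subComp (invRing ρ) (d + 1) ≤ subPos (invRing ρ) ^ (k + 1) ∧ x = ((d + 1 : ℕ) : ℕ∞)}
  have hs : betaGrp F G k ≤ sSup s := by
    refine iSup₂_le fun n ρ => sSup_le ?_
    rintro _ ⟨d, ⟨hd, hd'⟩, rfl⟩
    obtain ⟨d, rfl⟩ := Nat.exists_eq_succ_of_ne_zero hd.ne'
    exact le_sSup ⟨n, ρ, d, hd', rfl⟩
  have hne : s.Nonempty := by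
    by_contra hc
    rw [Set.not_nonempty_iff_eq_empty] at hc
    rw [hc, sSup_empty] at hs
    have := h1.trans hs
    simp at this
  refine (add_le_add_left hs B).trans ?_
  rw [ENat.sSup_add hne]
  refine iSup₂_le ?_
  rintro _ ⟨n, ρ, d, hd, rfl⟩
  exact h n ρ d hd

end BetaProd

/-- For integers `r, s ≥ 1` and finite groups `G`, `H` of order invertible in `F`,
`β_{r+s-1}(G × H) ≥ β_r(G) + β_s(H) - 1`. -/
theorem betaGrp_prod_ge {F : Type*} [Field F] {G H : Type*} [Group G] [Finite G]
    [Group H] [Finite H] (hG : (Nat.card G : F) ≠ 0) (hH : (Nat.card H : F) ≠ 0)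
    (r s : ℕ) (hr : 1 ≤ r) (hs : 1 ≤ s) :
    betaGrp F G r + betaGrp F H s - 1 ≤ betaGrp F (G × H) (r + s - 1) := by
  classical
  have := Fintype.ofFinite G
  have := Fintype.ofFinite H
  rw [Nat.card_eq_fintype_card] at hG hH
  rw [tsub_le_iff_right]
  refine BetaProd.le_of_forall (BetaProd.exists_nontriv F G r hr) fun n ρ d hd => ?_
  rw [add_comm]
  refine BetaProd.le_of_forall (BetaProd.exists_nontriv F H s hs) fun m σ e he => ?_
  obtain ⟨f, hf, hf'⟩ := BetaProd.exists_not_mem_of_not_le ρ hG hd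
  obtain ⟨g, hg, hg'⟩ := BetaProd.exists_not_mem_of_not_le σ hH he
  have h1 := BetaProd.exists_not_le (BetaProd.prodRep ρ σ)
    (hf.rename_isHomogeneous.mul hg.rename_isHomogeneous)
    (BetaProd.prod_not_mem ρ σ hG hH hf' hg')
  have h2 := BetaProd.le_betaGrp _ (by omega) h1
  have h3 : ((e + 1 : ℕ) : ℕ∞) + ((d + 1 : ℕ) : ℕ∞) = ((d + e + 1 : ℕ) : ℕ∞) + 1 := by
    push_cast
    ring
  rw [h3]
  gcongr
end

section
/- Let R be a finitely generated commutative graded F-algebra with R_0 = F. Then there exist non-negative integers k_0(R) and β_0(R) such that β_k(R) = k·σ(R) + β_0(R) for every k > k_0(R). -/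
open scoped ENNReal


/-- `R_+`, the span of the homogeneous elements of positive degree. -/
noncomputable def gradePos {F R : Type*} [Field F] [CommRing R] [Algebra F R]
    (𝒜 : ℕ → Submodule F R) : Submodule F R :=
  ⨆ d ∈ Set.Ioi (0 : ℕ), 𝒜 d

/-- `β_k(R)`, the top degree of `R_+/R_+^{k+1}`:  the supremum (in `ℕ∞`) of the degrees `d`
such that the degree `d` component of `R_+` is not contained in `R_+^{k+1}`. -/
noncomputable def gBeta {F R : Type*} [Field F] [CommRing R] [Algebra F R]
    (𝒜 : ℕ → Submodule F R) (k : ℕ) : ℕ∞ :=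
  sSup ((fun d : ℕ => (d : ℕ∞)) '' {d | 0 < d ∧ ¬ 𝒜 d ≤ gradePos 𝒜 ^ (k + 1)})

/-- `F[R_{≤ d}]`, the subalgebra of `R` generated by the homogeneous elements
of degree at most `d`. -/
noncomputable def gBelow {F R : Type*} [Field F] [CommRing R] [Algebra F R]
    (𝒜 : ℕ → Submodule F R) (d : ℕ) : Subalgebra F R :=
  Algebra.adjoin F (⋃ i ∈ Set.Iic d, (𝒜 i : Set R))

/-- `σ(R)`, the minimal `d` such that `R` is a finitely generated module over `F[R_{≤ d}]`. -/
noncomputable def gSigma {F R : Type*} [Field F] [CommRing R] [Algebra F R]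
    (𝒜 : ℕ → Submodule F R) : ℕ :=
  sInf {d : ℕ | Module.Finite (gBelow 𝒜 d) R}

/-- `η(R) = β(R_+, F[R_{≤ σ(R)}])`, the top degree of `R_+` modulo `(F[R_{≤ σ(R)}])_+ ⬝ R_+`. -/
noncomputable def gEta {F R : Type*} [Field F] [CommRing R] [Algebra F R]
    (𝒜 : ℕ → Submodule F R) : ℕ∞ :=
  sSup ((fun d : ℕ => (d : ℕ∞)) '' {d | 0 < d ∧
    ¬ 𝒜 d ≤ (Subalgebra.toSubmodule (gBelow 𝒜 (gSigma 𝒜)) ⊓ gradePos 𝒜) * gradePos 𝒜})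


open scoped DirectSum

section Comb
variable {ι : Type*} [Fintype ι]

theorem comb_stable (M : Set (ι →₀ ℕ)) (hM : IsLowerSet M) :
    ∃ m : ℕ, ∀ (i : ι) (a : ι →₀ ℕ), a ∈ M → m ≤ a i → ∀ l, a + Finsupp.single i l ∈ M := by
  classical
  have hfin : {b | Minimal (fun x => x ∉ M) b}.Finite :=
    (setOfPred_minimal_antichain _).finite_of_partiallyWellOrderedOn
      (Set.isPWO_of_wellQuasiOrderedLE _)
  refine ⟨hfin.toFinset.sup (fun b => b.degree), fun i a ha hm l => ?_⟩
  by_contra hcon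
  obtain ⟨b, hb1, hb2⟩ := exists_minimal_le_of_wellFoundedLT (fun x => x ∉ M) _ hcon
  have hbm : b.degree ≤ hfin.toFinset.sup (fun b => b.degree) :=
    Finset.le_sup (f := fun b : ι →₀ ℕ => b.degree) (by simpa using hb2)
  apply hb2.1
  refine hM (fun j => ?_) ha
  by_cases hj : j = i
  · subst hj
    exact (Finsupp.le_degree j b).trans (hbm.trans hm)
  · have := hb1 j
    simpa [Finsupp.single_apply, Ne.symm hj] using this

theorem comb_main (d : ι → ℕ) (M : Set (ι →₀ ℕ)) (hM : IsLowerSet M)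
    (m : ℕ) (hm : ∀ (i : ι) (a : ι →₀ ℕ), a ∈ M → m ≤ a i → ∀ l, a + Finsupp.single i l ∈ M)
    (hd : ∀ i, 0 < d i) (s : ℕ)
    (hs1 : ∀ i, (∀ l, Finsupp.single i l ∈ M) → d i ≤ s)
    (hs2 : s = 0 ∨ ∃ i, d i = s ∧ ∀ l, Finsupp.single i l ∈ M) :
    ∃ k₀ β₀ : ℕ, ∀ k : ℕ, k₀ < k →
      (∀ a ∈ M, a.degree ≤ k → Finsupp.weight d a ≤ k * s + β₀) ∧
      (k * s + β₀ = 0 ∨ ∃ a ∈ M, a.degree ≤ k ∧ Finsupp.weight d a = k * s + β₀) := by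
  classical
  have hbig : ∀ a ∈ M, ∀ i, s < d i → a i < m := by
    intro a ha i hi
    by_contra hcon
    have h1 := hm i a ha (by omega)
    have := hs1 i (fun l => hM (by simp) (h1 l))
    omega
  have key : ∀ (a : ι →₀ ℕ) (t : ℕ), (∀ i, t < d i → a i < m) →
      Finsupp.weight d a ≤ t * a.degree + ∑ i, m * d i := by
    intro a t h
    rw [Finsupp.weight_eq_sum, Finsupp.degree_eq_sum, Finset.mul_sum, ← Finset.sum_add_distrib]
    refine Finset.sum_le_sum fun i _ => ?_
    simp only [smul_eq_mul]
    by_cases hi : t < d i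
    · have := h i hi
      nlinarith
    · push Not at hi
      nlinarith
  set C := ∑ i, m * d i with hC
  rcases hs2 with rfl | ⟨i0, hi0, hi0M⟩
  · have hbd : ∀ a ∈ M, Finsupp.weight d a ≤ C := by
      intro a ha
      simpa using key a 0 (hbig a ha)
    by_cases hne : M.Nonempty
    · obtain ⟨a0, ha0⟩ := hne
      let Q : ℕ → Prop := fun n => ∃ a ∈ M, Finsupp.weight d a = n
      have hQ : Q (Nat.findGreatest Q C) :=
        Nat.findGreatest_spec (P := Q) (hbd a0 ha0) ⟨a0, ha0, rfl⟩
      obtain ⟨b, hb, hbw⟩ := hQ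
      refine ⟨b.degree, Nat.findGreatest Q C, fun k hk => ⟨fun a ha _ => ?_, Or.inr ⟨b, hb, hk.le, ?_⟩⟩⟩
      · have := Nat.le_findGreatest (P := Q) (hbd a ha) ⟨a, ha, rfl⟩
        omega
      · omega
    · refine ⟨0, 0, fun k _ => ⟨fun a ha _ => absurd ⟨a, ha⟩ hne, Or.inl (by simp)⟩⟩
  · have hspos : 0 < s := hi0 ▸ hd i0
    let Gd : Set (ι →₀ ℕ) := {a | ∃ i, d i = s ∧ ∀ l, a + Finsupp.single i l ∈ M}
    have hGM : Gd ⊆ M := by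
      rintro a ⟨i, _, h⟩
      simpa using h 0
    let Q : ℕ → Prop := fun n => ∃ a ∈ Gd, Finsupp.weight d a = s * a.degree + n
    have hQb : ∀ n, Q n → n ≤ C := by
      rintro n ⟨a, ha, hw⟩
      have := key a s (hbig a (hGM ha))
      omega
    have hQ : Q (Nat.findGreatest Q C) :=
      Nat.findGreatest_spec (P := Q) (Nat.zero_le C)
        ⟨0, ⟨i0, hi0, by simpa using hi0M⟩, by simp⟩
    obtain ⟨b, ⟨j, hj, hbj⟩, hbw⟩ := hQ
    refine ⟨b.degree + C, Nat.findGreatest Q C, fun k hk => ⟨fun a ha hak => ?_, Or.inr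
      ⟨b + Finsupp.single j (k - b.degree), hbj _, ?_, ?_⟩⟩⟩
    · by_cases hg : a ∈ Gd
      · have h1 : s * a.degree ≤ k * s := by nlinarith
        by_cases hlt : s * a.degree ≤ Finsupp.weight d a
        · have hq : Q (Finsupp.weight d a - s * a.degree) := ⟨a, hg, by omega⟩
          have := Nat.le_findGreatest (P := Q) (hQb _ hq) hq
          omega
        · omega
      · have h2 := key a (s - 1) (by
          intro i hi
          rcases (show s < d i ∨ d i = s by omega) with h | h
          · exact hbig a ha i h
          · by_contra hcon
            exact hg ⟨i, h, hm i a ha (by omega)⟩)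
        obtain ⟨t, rfl⟩ : ∃ t, s = t + 1 := ⟨s - 1, by omega⟩
        simp only [Nat.add_sub_cancel] at h2
        nlinarith
    · simp only [map_add, Finsupp.degree_single]
      omega
    · simp only [map_add, Finsupp.weight_single, smul_eq_mul, hj, hbw]
      obtain ⟨t, rfl⟩ : ∃ t, k = b.degree + t := ⟨k - b.degree, by omega⟩
      simp only [Nat.add_sub_cancel_left]
      ring

end Comb

section Alg
variable {F R : Type*} [Field F] [CommRing R] [Algebra F R]
  (𝒜 : ℕ → Submodule F R) [GradedAlgebra 𝒜]

theorem exists_gens (h0 : 𝒜 0 = 1) (hfg : Algebra.FiniteType F R) :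
    ∃ S : Finset (R × ℕ), (∀ p ∈ S, p.1 ∈ 𝒜 p.2 ∧ 0 < p.2) ∧
      Algebra.adjoin F (Set.range fun p : S => p.1.1) = ⊤ := by
  classical
  obtain ⟨t, ht⟩ := hfg.out
  refine ⟨t.biUnion fun x => ((DirectSum.decompose 𝒜 x).support.filter (0 < ·)).image
    fun j => ((DirectSum.decompose 𝒜 x j : R), j), ?_, ?_⟩
  · intro p hp
    simp only [Finset.mem_biUnion, Finset.mem_image, Finset.mem_filter] at hp
    obtain ⟨x, hx, j, ⟨_, hj⟩, rfl⟩ := hp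
    exact ⟨(DirectSum.decompose 𝒜 x j).2, hj⟩
  · rw [eq_top_iff, ← ht, Algebra.adjoin_le_iff]
    intro x hx
    rw [← DirectSum.sum_support_decompose 𝒜 x]
    refine Subalgebra.sum_mem _ fun j hj => ?_
    by_cases hj0 : 0 < j
    · apply Algebra.subset_adjoin
      refine ⟨⟨((DirectSum.decompose 𝒜 x j : R), j), ?_⟩, rfl⟩
      simp only [Finset.mem_biUnion, Finset.mem_image, Finset.mem_filter]
      exact ⟨x, hx, j, ⟨hj, hj0⟩, rfl⟩
    · obtain rfl : j = 0 := by omega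
      have h1 : (DirectSum.decompose 𝒜 x 0 : R) ∈ (1 : Submodule F R) :=
        h0 ▸ (DirectSum.decompose 𝒜 x 0).2
      obtain ⟨c, hc⟩ := Submodule.mem_one.1 h1
      rw [← hc]
      exact Subalgebra.algebraMap_mem _ c

theorem mem_gradePos {x : R} {d : ℕ} (hd : 0 < d) (hx : x ∈ 𝒜 d) : x ∈ gradePos 𝒜 :=
  Submodule.mem_iSup_of_mem d (Submodule.mem_iSup_of_mem hd hx)

theorem gradePos_mul : gradePos 𝒜 * gradePos 𝒜 ≤ gradePos 𝒜 := by
  unfold gradePos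
  simp only [Submodule.iSup_mul, Submodule.mul_iSup]
  refine iSup₂_le fun i hi => iSup₂_le fun j hj => ?_
  rw [Submodule.mul_le]
  intro x hx y hy
  have hi' : 0 < i := hi
  have hj' : 0 < j := hj
  refine mem_gradePos 𝒜 (d := i + j) (by omega) ?_
  first
    | exact SetLike.mul_mem_graded hx hy
    | (rw [add_comm i j, mul_comm]; exact SetLike.mul_mem_graded hy hx)
    | (rw [mul_comm]; exact SetLike.mul_mem_graded hy hx)

theorem gradePos_pow_anti {j k : ℕ} (h : j ≤ k) :
    gradePos 𝒜 ^ (k + 1) ≤ gradePos 𝒜 ^ (j + 1) := by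
  induction k, h using Nat.le_induction with
  | base => exact le_rfl
  | succ k hk ih =>
    refine le_trans ?_ ih
    rw [pow_succ, pow_succ, mul_assoc]
    exact mul_le_mul' le_rfl (gradePos_mul 𝒜)

variable {ι : Type*} (f : ι → R)

noncomputable def mon (a : ι →₀ ℕ) : R := a.prod fun i n => f i ^ n

theorem mon_add (a b : ι →₀ ℕ) : mon f (a + b) = mon f a * mon f b :=
  Finsupp.prod_add_index' (by simp) (by intros; rw [pow_add])

theorem mon_zero : mon f 0 = 1 := by simp [mon]

theorem mon_single (i : ι) (n : ℕ) : mon f (Finsupp.single i n) = f i ^ n := by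
  simp [mon]

theorem span_mon (hf : Algebra.adjoin F (Set.range f) = ⊤) :
    Submodule.span F (Set.range (mon f)) = ⊤ := by
  rw [eq_top_iff]
  intro x _
  have hx : x ∈ Algebra.adjoin F (Set.range f) := hf ▸ Algebra.mem_top
  rw [Algebra.adjoin_range_eq_range_aeval] at hx
  obtain ⟨p, rfl⟩ := hx
  show (MvPolynomial.aeval f) p ∈ _
  rw [MvPolynomial.aeval_def, MvPolynomial.eval₂_eq]
  refine Submodule.sum_mem _ fun a _ => ?_
  rw [← Algebra.smul_def]
  exact Submodule.smul_mem _ _ (Submodule.subset_span ⟨a, rfl⟩)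

variable {d : ι → ℕ}

theorem mon_mem (hfd : ∀ i, f i ∈ 𝒜 (d i)) (a : ι →₀ ℕ) : mon f a ∈ 𝒜 (Finsupp.weight d a) := by
  classical
  induction a using Finsupp.induction_linear with
  | zero =>
    rw [mon_zero, map_zero]
    exact SetLike.GradedOne.one_mem
  | add a b ha hb =>
    rw [mon_add, map_add]
    exact SetLike.mul_mem_graded ha hb
  | single i n =>
    rw [mon_single, Finsupp.weight_single]
    exact SetLike.pow_mem_graded n (hfd i)

theorem mon_mem_pow (hfd : ∀ i, f i ∈ 𝒜 (d i)) (hd : ∀ i, 0 < d i) (a : ι →₀ ℕ) :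
    mon f a ∈ gradePos 𝒜 ^ a.degree := by
  classical
  induction a using Finsupp.induction_linear with
  | zero =>
    rw [mon_zero, map_zero, pow_zero]
    exact Submodule.one_le.1 le_rfl
  | add a b ha hb =>
    rw [mon_add, map_add, pow_add]
    exact Submodule.mul_mem_mul ha hb
  | single i n =>
    rw [mon_single, Finsupp.degree_single]
    exact Submodule.pow_mem_pow _ (mem_gradePos 𝒜 (hd i) (hfd i)) n

theorem span_hom (hfd : ∀ i, f i ∈ 𝒜 (d i)) (S : Set (ι →₀ ℕ)) {x : R} {D : ℕ}
    (hx : x ∈ Submodule.span F (mon f '' S)) (hxD : x ∈ 𝒜 D) :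
    x ∈ Submodule.span F (mon f '' {b | b ∈ S ∧ Finsupp.weight d b = D}) := by
  rw [← DirectSum.decompose_of_mem_same 𝒜 hxD]
  clear hxD
  induction hx using Submodule.span_induction with
  | mem x h =>
    obtain ⟨b, hb, rfl⟩ := h
    by_cases hw : Finsupp.weight d b = D
    · rw [DirectSum.decompose_of_mem_same 𝒜 (hw ▸ mon_mem 𝒜 f hfd b)]
      exact Submodule.subset_span ⟨b, ⟨hb, hw⟩, rfl⟩
    · rw [DirectSum.decompose_of_mem_ne 𝒜 (mon_mem 𝒜 f hfd b) hw]
      exact Submodule.zero_mem _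
  | zero => simp
  | add x y _ _ hx hy =>
    simpa [DirectSum.decompose_add] using Submodule.add_mem _ hx hy
  | smul c x _ hx =>
    rw [DirectSum.decompose_smul]
    exact Submodule.smul_mem _ c hx

theorem pow_le_span (hfd : ∀ i, f i ∈ 𝒜 (d i))
    (hf : Algebra.adjoin F (Set.range f) = ⊤) (j : ℕ) :
    gradePos 𝒜 ^ j ≤ Submodule.span F (mon f '' {b | j ≤ b.degree}) := by
  induction j with
  | zero =>
    rw [pow_zero, Submodule.one_le]
    exact Submodule.subset_span ⟨0, by simp, mon_zero f⟩
  | succ j ih =>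
    have h1 : gradePos 𝒜 ≤ Submodule.span F (mon f '' {b | 1 ≤ b.degree}) := by
      refine iSup₂_le fun D hD x hx => ?_
      have h2 : x ∈ Submodule.span F (mon f '' Set.univ) := by
        rw [Set.image_univ, span_mon f hf]; trivial
      refine Submodule.span_mono (Set.image_mono ?_) (span_hom 𝒜 f hfd _ h2 hx)
      rintro b ⟨_, hb⟩
      show 1 ≤ b.degree
      by_contra hcon
      have hb0 : b = 0 := by
        rw [← Finsupp.degree_eq_zero_iff]; omega
      subst hb0
      have : 0 < D := hD
      simp at hb
      omega
    rw [pow_succ]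
    refine (mul_le_mul' ih h1).trans ?_
    rw [Submodule.span_mul_span]
    refine Submodule.span_mono ?_
    rintro _ ⟨_, ⟨a, ha, rfl⟩, _, ⟨b, hb, rfl⟩, rfl⟩
    refine ⟨a + b, ?_, mon_add f a b⟩
    simp only [Set.mem_setOf_eq, map_add] at *
    omega

/-- exponents of monomials with nonzero initial form -/
def goodSet : Set (ι →₀ ℕ) := {a | mon f a ∉ gradePos 𝒜 ^ (a.degree + 1)}

theorem goodSet_lower (hfd : ∀ i, f i ∈ 𝒜 (d i)) (hd : ∀ i, 0 < d i) :
    IsLowerSet (goodSet 𝒜 f) := by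
  intro a b hba ha hb
  apply ha
  obtain ⟨c, rfl⟩ := exists_add_of_le hba
  rw [mon_add, map_add, show b.degree + c.degree + 1 = (b.degree + 1) + c.degree by ring, pow_add]
  exact Submodule.mul_mem_mul hb (mon_mem_pow 𝒜 f hfd hd c)

theorem degree_le_weight [Fintype ι] (hd : ∀ i, 0 < d i) (a : ι →₀ ℕ) : a.degree ≤ Finsupp.weight d a := by
  rw [Finsupp.weight_eq_sum, Finsupp.degree_eq_sum]
  exact Finset.sum_le_sum fun i _ => Nat.le_mul_of_pos_right _ (hd i)

theorem mon_mem_good [Fintype ι] (hfd : ∀ i, f i ∈ 𝒜 (d i)) (hd : ∀ i, 0 < d i)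
    (hf : Algebra.adjoin F (Set.range f) = ⊤) (D : ℕ) (n : ℕ) :
    ∀ a : ι →₀ ℕ, Finsupp.weight d a = D → D ≤ a.degree + n →
    mon f a ∈ Submodule.span F
      (mon f '' {b | b ∈ goodSet 𝒜 f ∧ Finsupp.weight d b = D}) := by
  have step : ∀ a : ι →₀ ℕ, Finsupp.weight d a = D →
      (∀ b : ι →₀ ℕ, Finsupp.weight d b = D → a.degree + 1 ≤ b.degree →
        mon f b ∈ Submodule.span F
          (mon f '' {b | b ∈ goodSet 𝒜 f ∧ Finsupp.weight d b = D})) →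
      mon f a ∈ Submodule.span F
        (mon f '' {b | b ∈ goodSet 𝒜 f ∧ Finsupp.weight d b = D}) := by
    intro a ha h
    by_cases hg : a ∈ goodSet 𝒜 f
    · exact Submodule.subset_span ⟨a, ⟨hg, ha⟩, rfl⟩
    · have h1 : mon f a ∈ gradePos 𝒜 ^ (a.degree + 1) := not_not.1 hg
      have h2 := span_hom 𝒜 f hfd _ (pow_le_span 𝒜 f hfd hf _ h1) (ha ▸ mon_mem 𝒜 f hfd a)
      refine Submodule.span_le.2 ?_ h2
      rintro _ ⟨b, ⟨hb1, hb2⟩, rfl⟩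
      exact h b hb2 hb1
  induction n with
  | zero =>
    intro a ha hn
    refine step a ha fun b hb hab => ?_
    have := degree_le_weight hd b
    omega
  | succ n ih =>
    intro a ha hn
    exact step a ha fun b hb hab => ih b hb (by omega)

theorem mem_span_good [Fintype ι] (hfd : ∀ i, f i ∈ 𝒜 (d i)) (hd : ∀ i, 0 < d i)
    (hf : Algebra.adjoin F (Set.range f) = ⊤) {D : ℕ} {x : R} (hx : x ∈ 𝒜 D) :
    x ∈ Submodule.span F
      (mon f '' {b | b ∈ goodSet 𝒜 f ∧ Finsupp.weight d b = D}) := by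
  have h2 : x ∈ Submodule.span F (mon f '' Set.univ) := by
    rw [Set.image_univ, span_mon f hf]; trivial
  refine Submodule.span_le.2 ?_ (span_hom 𝒜 f hfd _ h2 hx)
  rintro _ ⟨b, ⟨_, hb⟩, rfl⟩
  exact mon_mem_good 𝒜 f hfd hd hf D D b hb (by omega)

theorem not_le_iff [Fintype ι] (hfd : ∀ i, f i ∈ 𝒜 (d i)) (hd : ∀ i, 0 < d i)
    (hf : Algebra.adjoin F (Set.range f) = ⊤) (D k : ℕ) :
    ¬ 𝒜 D ≤ gradePos 𝒜 ^ (k + 1) ↔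
      ∃ a ∈ goodSet 𝒜 f, a.degree ≤ k ∧ Finsupp.weight d a = D := by
  constructor
  · intro h
    by_contra hcon
    push Not at hcon
    apply h
    intro x hx
    refine Submodule.span_le.2 ?_ (mem_span_good 𝒜 f hfd hd hf hx)
    rintro _ ⟨b, ⟨hb, hbD⟩, rfl⟩
    have h1 : k < b.degree := by
      by_contra hlt
      exact hcon b hb (by omega) hbD
    obtain ⟨t, ht⟩ : ∃ t, b.degree = t + 1 := ⟨b.degree - 1, by omega⟩
    have h2 := mon_mem_pow 𝒜 f hfd hd b
    rw [ht] at h2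
    exact gradePos_pow_anti 𝒜 (by omega) h2
  · rintro ⟨a, ha, hak, rfl⟩ h
    exact ha (gradePos_pow_anti 𝒜 hak (h (mon_mem 𝒜 f hfd a)))

theorem finite_below [Fintype ι] (hfd : ∀ i, f i ∈ 𝒜 (d i)) (hd : ∀ i, 0 < d i)
    (hf : Algebra.adjoin F (Set.range f) = ⊤) (s m : ℕ)
    (hm : ∀ a ∈ goodSet 𝒜 f, ∀ i, s < d i → a i ≤ m) :
    Module.Finite (gBelow 𝒜 s) R := by
  classical
  have hbel : ∀ a : ι →₀ ℕ, (∀ i, a i ≠ 0 → d i ≤ s) → mon f a ∈ gBelow 𝒜 s := by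
    intro a ha
    refine Subalgebra.prod_mem _ fun i hi => Subalgebra.pow_mem _ ?_ _
    apply Algebra.subset_adjoin
    simp only [Set.mem_iUnion]
    exact ⟨d i, ha i (by simpa using hi), hfd i⟩
  let S : Set R := mon f '' Set.Iic (Finsupp.equivFunOnFinite.symm fun _ => m)
  have hS : S.Finite := (Set.finite_Iic _).image _
  have key : ∀ a ∈ goodSet 𝒜 f, mon f a ∈ Submodule.span (gBelow 𝒜 s) S := by
    intro a ha
    have h1 : a = a.filter (fun i => d i ≤ s) + a.filter (fun i => ¬ d i ≤ s) :=
      (Finsupp.filter_pos_add_filter_neg a _).symm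
    rw [h1, mon_add]
    have h2 : mon f (a.filter (fun i => d i ≤ s)) ∈ gBelow 𝒜 s := by
      apply hbel
      intro i hi
      by_contra hcon
      exact hi (by simp [Finsupp.filter_apply, hcon])
    have h3 : mon f (a.filter (fun i => ¬ d i ≤ s)) ∈ S := by
      refine ⟨_, ?_, rfl⟩
      intro i
      by_cases hi : d i ≤ s
      · simp [Finsupp.filter_apply, hi]
      · have := hm a ha i (by omega)
        simpa [Finsupp.filter_apply, hi, not_le.1 hi] using this
    exact Submodule.smul_mem _ (⟨_, h2⟩ : gBelow 𝒜 s) (Submodule.subset_span h3)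
  refine ⟨Submodule.fg_def.2 ⟨S, hS, ?_⟩⟩
  rw [eq_top_iff]
  intro x _
  rw [← DirectSum.sum_support_decompose 𝒜 x]
  refine Submodule.sum_mem _ fun D _ => ?_
  have h4 := mem_span_good 𝒜 f hfd hd hf (DirectSum.decompose 𝒜 x D).2
  have h5 : Submodule.span F (mon f '' {b | b ∈ goodSet 𝒜 f ∧ Finsupp.weight d b = D}) ≤
      (Submodule.span (gBelow 𝒜 s) S).restrictScalars F := by
    rw [Submodule.span_le]
    rintro _ ⟨b, ⟨hb, _⟩, rfl⟩
    exact key b hb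
  exact h5 h4

theorem pow_of_finite (h0 : 𝒜 0 = 1) (σ : ℕ) (hfin : Module.Finite (gBelow 𝒜 σ) R) :
    ∃ c : ℕ, ∀ (D j : ℕ), σ * j + c < D → 𝒜 D ≤ gradePos 𝒜 ^ (j + 1) := by
  classical
  obtain ⟨G, hG⟩ := hfin.fg_top
  let c := G.sup fun g => (DirectSum.decompose 𝒜 g).support.sup id
  refine ⟨c, ?_⟩
  let T : Submodule F R :=
    { carrier := {x | ∀ D j, σ * j + c < D → (DirectSum.decompose 𝒜 x D : R) ∈ gradePos 𝒜 ^ (j + 1)}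
      zero_mem' := by intro D j _; simp
      add_mem' := by
        intro x y hx hy D j h
        simpa [DirectSum.decompose_add] using Submodule.add_mem _ (hx D j h) (hy D j h)
      smul_mem' := by
        intro r x hx D j h
        rw [DirectSum.decompose_smul]
        exact Submodule.smul_mem _ r (hx D j h) }
  have hT : ∀ x, x ∈ T ↔ ∀ D j, σ * j + c < D →
    (DirectSum.decompose 𝒜 x D : R) ∈ gradePos 𝒜 ^ (j + 1) := fun x => Iff.rfl
  have hmul : ∀ r ∈ gBelow 𝒜 σ, ∀ x ∈ T, r * x ∈ T := by
    intro r hr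
    induction hr using Algebra.adjoin_induction with
    | mem r hr =>
      simp only [Set.mem_iUnion] at hr
      obtain ⟨i, hi, hri⟩ := hr
      have hi' : i ≤ σ := hi
      intro x hx
      rcases Nat.eq_zero_or_pos i with rfl | hipos
      · have hri' : r ∈ (1 : Submodule F R) := h0 ▸ hri
        obtain ⟨q, rfl⟩ := Submodule.mem_one.1 hri'
        rw [← Algebra.smul_def]
        exact T.smul_mem q hx
      · rw [hT]
        intro D j h
        by_cases hD : i ≤ D
        · rw [DirectSum.coe_decompose_mul_of_left_mem_of_le 𝒜 hri hD]
          rcases j with _ | j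
          · rcases Nat.eq_or_lt_of_le hD with rfl | hlt
            · rw [Nat.sub_self]
              have h1 : (DirectSum.decompose 𝒜 x 0 : R) ∈ (1 : Submodule F R) :=
                h0 ▸ (DirectSum.decompose 𝒜 x 0).2
              have h2 := Submodule.mul_mem_mul (mem_gradePos 𝒜 hipos hri) h1
              simpa using h2
            · have h2 := Submodule.mul_mem_mul (mem_gradePos 𝒜 hipos hri)
                (mem_gradePos 𝒜 (Nat.sub_pos_of_lt hlt) (DirectSum.decompose 𝒜 x (D - i)).2)
              simpa using gradePos_mul 𝒜 h2
          · rw [pow_succ']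
            refine Submodule.mul_mem_mul (mem_gradePos 𝒜 hipos hri) (hx _ _ ?_)
            rw [Nat.mul_succ] at h
            omega
        · rw [DirectSum.coe_decompose_mul_of_left_mem_of_not_le 𝒜 hri hD]
          exact Submodule.zero_mem _
    | algebraMap q =>
      intro x hx
      rw [← Algebra.smul_def]
      exact T.smul_mem q hx
    | add a b _ _ ha hb =>
      intro x hx
      rw [add_mul]
      exact T.add_mem (ha x hx) (hb x hx)
    | mul a b _ _ ha hb =>
      intro x hx
      rw [mul_assoc]
      exact ha _ (hb x hx)
  have hall : ∀ x : R, x ∈ T := by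
    intro x
    have hx : x ∈ Submodule.span (gBelow 𝒜 σ) (G : Set R) := hG ▸ Submodule.mem_top
    induction hx using Submodule.span_induction with
    | mem g hg =>
      rw [hT]
      intro D j h
      have : DirectSum.decompose 𝒜 g D = 0 := by
        by_contra hne
        have h1 : D ≤ (DirectSum.decompose 𝒜 g).support.sup id :=
          Finset.le_sup (f := id) (by simpa using hne)
        have h2 : (DirectSum.decompose 𝒜 g).support.sup id ≤ c :=
          Finset.le_sup (f := fun g => (DirectSum.decompose 𝒜 g).support.sup id) hg
        omega
      rw [this]
      exact Submodule.zero_mem _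
    | zero => exact T.zero_mem
    | add x y _ _ hx hy => exact T.add_mem hx hy
    | smul r x _ hx => exact hmul r.1 r.2 x hx
  intro D j h x hx
  have := (hT x).1 (hall x) D j h
  rwa [DirectSum.decompose_of_mem_same 𝒜 hx] at this

end Alg

/-- For a finitely generated commutative graded `F`-algebra `R` with `R_0 = F`, the function
`β_k(R)` is eventually linear in `k` with slope `σ(R)`. -/
theorem gBeta_eventually_linear {F R : Type*} [Field F] [CommRing R] [Algebra F R]
    (𝒜 : ℕ → Submodule F R) [GradedAlgebra 𝒜] (h0 : 𝒜 0 = 1)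
    (hfg : Algebra.FiniteType F R) :
    ∃ k₀ β₀ : ℕ, ∀ k : ℕ, k₀ < k → gBeta 𝒜 k = ((k * gSigma 𝒜 + β₀ : ℕ) : ℕ∞) := by
  classical
  obtain ⟨S, hS, hf⟩ := exists_gens 𝒜 h0 hfg
  let f : S → R := fun p => p.1.1
  let d : S → ℕ := fun p => p.1.2
  have hfd : ∀ i, f i ∈ 𝒜 (d i) := fun i => (hS i.1 i.2).1
  have hd : ∀ i, 0 < d i := fun i => (hS i.1 i.2).2
  replace hf : Algebra.adjoin F (Set.range f) = ⊤ := hf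
  have hM := goodSet_lower 𝒜 f hfd hd
  obtain ⟨m, hm⟩ := comb_stable _ hM
  let U : Finset S := Finset.univ.filter fun i => ∀ l, Finsupp.single i l ∈ goodSet 𝒜 f
  let s := U.sup d
  have hs1 : ∀ i, (∀ l, Finsupp.single i l ∈ goodSet 𝒜 f) → d i ≤ s := fun i hi =>
    Finset.le_sup (f := d) (by simpa [U] using hi)
  have hs2 : s = 0 ∨ ∃ i, d i = s ∧ ∀ l, Finsupp.single i l ∈ goodSet 𝒜 f := by
    rcases U.eq_empty_or_nonempty with h | h
    · left; simp [s, h]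
    · right
      obtain ⟨i, hi, his⟩ := Finset.exists_mem_eq_sup U h d
      exact ⟨i, his.symm, by simpa [U] using hi⟩
  have hfin : Module.Finite (gBelow 𝒜 s) R := by
    refine finite_below 𝒜 f hfd hd hf s m fun a ha i hi => ?_
    by_contra hcon
    have h1 := hm i a ha (by omega)
    have := hs1 i (fun l => hM (by simp) (h1 l))
    omega
  have hσ : gSigma 𝒜 = s := by
    refine le_antisymm (Nat.sInf_le hfin) ?_
    have hfin' : Module.Finite (gBelow 𝒜 (gSigma 𝒜)) R :=
      Nat.sInf_mem (s := {d : ℕ | Module.Finite (gBelow 𝒜 d) R}) ⟨s, hfin⟩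
    rcases hs2 with h | ⟨i, hi, hil⟩
    · omega
    · by_contra hcon
      push Not at hcon
      obtain ⟨c, hc⟩ := pow_of_finite 𝒜 h0 _ hfin'
      apply hil (c + 1)
      rw [Finsupp.degree_single]
      refine hc (Finsupp.weight d (Finsupp.single i (c + 1))) (c + 1) ?_ (mon_mem 𝒜 f hfd _)
      rw [Finsupp.weight_single, smul_eq_mul, hi]
      nlinarith
  obtain ⟨k₀, β₀, h⟩ := comb_main d _ hM m hm hd s hs1 hs2
  refine ⟨k₀, β₀, fun k hk => ?_⟩
  obtain ⟨hu, hl⟩ := h k hk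
  rw [hσ]
  unfold gBeta
  apply le_antisymm
  · apply sSup_le
    rintro _ ⟨D, ⟨_, hD⟩, rfl⟩
    obtain ⟨a, ha, hak, rfl⟩ := (not_le_iff 𝒜 f hfd hd hf D k).1 hD
    exact Nat.cast_le.2 (hu a ha hak)
  · rcases Nat.eq_zero_or_pos (k * s + β₀) with hz | hp
    · rw [hz]; simp
    · rcases hl with hz | hl
      · omega
      · exact le_sSup ⟨_, ⟨hp, (not_le_iff 𝒜 f hfd hd hf _ k).2 hl⟩, rfl⟩
end
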